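/- arXiv:2602.13095 — 2 statements merged into one kernel-verified Lean document; each statement's English description precedes it below -/
import Mathlib

section
/- Let L_t be a time-dependent GKSL generator with Hermitian jump operators satisfying Condition Q, with t ↦ H_t continuous. Then the following are equivalent: (1) C^Int = {c·I : c ∈ ℂ}; (2) for every density matrix ρ0 and every solution ρ_t of the GKSL equation with initial condition ρ_0 = ρ0, one has lim_{t→∞} ρ_t = I/d. -/
open Matrix Filter
open scoped ComplexOrder

attribute [local instance] Matrix.normedAddCommGroup Matrix.normedSpace

noncomputable def hsNorm {d : ℕ} (A : Matrix (Fin d) (Fin d) ℂ) : ℝ :=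
  Real.sqrt ((Matrix.trace (Aᴴ * A)).re)

noncomputable def opNorm2 {d : ℕ}
    (Φ : Matrix (Fin d) (Fin d) ℂ → Matrix (Fin d) (Fin d) ℂ) : ℝ :=
  sSup {r : ℝ | ∃ A, hsNorm A = 1 ∧ r = hsNorm (Φ A)}

noncomputable def gksl {d M : ℕ} (H : ℝ → Matrix (Fin d) (Fin d) ℂ)
    (L : Fin M → ℝ → Matrix (Fin d) (Fin d) ℂ) (t : ℝ)
    (ρ : Matrix (Fin d) (Fin d) ℂ) : Matrix (Fin d) (Fin d) ℂ :=
  (-Complex.I) • (H t * ρ - ρ * H t) +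
    ∑ m : Fin M, (L m t * ρ * L m t - (2⁻¹ : ℂ) • ((L m t) ^ 2 * ρ + ρ * (L m t) ^ 2))

def CondQ {d : ℕ}
    (ℒ : ℝ → Matrix (Fin d) (Fin d) ℂ → Matrix (Fin d) (Fin d) ℂ) : Prop :=
  (∀ t0 : ℝ, 0 ≤ t0 → ∀ ε > (0 : ℝ), ∃ δ > (0 : ℝ), ∀ t : ℝ, 0 ≤ t → |t - t0| < δ →
      opNorm2 (fun A => ℒ t A - ℒ t0 A) < ε) ∧
  (∃ M > (0 : ℝ), ∀ t : ℝ, 0 ≤ t → opNorm2 (ℒ t) ≤ M) ∧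
  (∀ ε > (0 : ℝ), ∀ δ > (0 : ℝ), ∀ t0 : ℝ, 0 ≤ t0 →
    ∃ ts : ℕ → ℝ, (∀ n, 0 ≤ ts n) ∧ (∀ n, ts n + δ < ts (n + 1)) ∧
      ∀ n, ∀ t ∈ Set.Icc (0 : ℝ) δ,
        opNorm2 (fun A => ℒ (ts n + t) A - ℒ (t0 + t) A) < ε)

def IsDensity {d : ℕ} (ρ : Matrix (Fin d) (Fin d) ℂ) : Prop :=
  ρ.PosSemidef ∧ Matrix.trace ρ = 1


theorem hd_mul {d : ℕ} {f g : ℝ → Matrix (Fin d) (Fin d) ℂ} {fD gD : Matrix (Fin d) (Fin d) ℂ} {t : ℝ}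
    (hf : HasDerivAt f fD t) (hg : HasDerivAt g gD t) :
    HasDerivAt (fun s => f s * g s) (fD * g t + f t * gD) t := by
  refine hasDerivAt_pi.2 fun i => ?_
  refine hasDerivAt_pi.2 fun j => ?_
  have hfD : ∀ i j, HasDerivAt (fun s => f s i j) (fD i j) t := fun i j =>
    (hasDerivAt_pi.1 ((hasDerivAt_pi.1 hf) i)) j
  have hgD : ∀ i j, HasDerivAt (fun s => g s i j) (gD i j) t := fun i j =>
    (hasDerivAt_pi.1 ((hasDerivAt_pi.1 hg) i)) j
  have := HasDerivAt.fun_sum (u := Finset.univ) (fun k _ => (hfD i k).mul (hgD k j))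
  simpa [Matrix.mul_apply, Finset.sum_add_distrib] using this

theorem hd_ct {d : ℕ} {f : ℝ → Matrix (Fin d) (Fin d) ℂ} {fD : Matrix (Fin d) (Fin d) ℂ} {t : ℝ}
    (hf : HasDerivAt f fD t) :
    HasDerivAt (fun s => (f s)ᴴ) (fDᴴ) t := by
  refine hasDerivAt_pi.2 fun i => ?_
  refine hasDerivAt_pi.2 fun j => ?_
  exact ((hasDerivAt_pi.1 ((hasDerivAt_pi.1 hf) j)) i).star

theorem hd_tr {d : ℕ} {f : ℝ → Matrix (Fin d) (Fin d) ℂ} {fD : Matrix (Fin d) (Fin d) ℂ} {t : ℝ}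
    (hf : HasDerivAt f fD t) :
    HasDerivAt (fun s => Matrix.trace (f s)) (Matrix.trace fD) t := by
  have := HasDerivAt.fun_sum (u := Finset.univ) (fun k _ => (hasDerivAt_pi.1 ((hasDerivAt_pi.1 hf) k)) k)
  simpa [Matrix.trace] using this

noncomputable def hsq {d : ℕ} (A : Matrix (Fin d) (Fin d) ℂ) : ℝ := (Matrix.trace (Aᴴ * A)).re

theorem hsq_eq {d : ℕ} (A : Matrix (Fin d) (Fin d) ℂ) : hsq A = ∑ i, ∑ j, ‖A j i‖ ^ 2 := by
  simp [hsq, Matrix.trace, Matrix.mul_apply, Complex.sq_norm, Complex.normSq_apply]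

theorem hsq_nonneg {d : ℕ} (A : Matrix (Fin d) (Fin d) ℂ) : 0 ≤ hsq A := by
  rw [hsq_eq]; positivity

theorem norm_le_hsNorm {d : ℕ} (A : Matrix (Fin d) (Fin d) ℂ) : ‖A‖ ≤ hsNorm A := by
  refine (Matrix.norm_le_iff (Real.sqrt_nonneg _)).2 ?_
  intro i j
  refine Real.le_sqrt_of_sq_le ?_
  change _ ≤ hsq A
  rw [hsq_eq]
  refine le_trans ?_ (Finset.single_le_sum (f := fun i => ∑ j, ‖A j i‖ ^ 2) (fun _ _ => by positivity) (Finset.mem_univ j))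
  exact (Finset.single_le_sum (f := fun i => ‖A i j‖ ^ 2) (fun _ _ => by positivity) (Finset.mem_univ i))

theorem hsNorm_le {d : ℕ} (A : Matrix (Fin d) (Fin d) ℂ) : hsNorm A ≤ d * ‖A‖ := by
  refine Real.sqrt_le_iff.2 ⟨by positivity, ?_⟩
  change hsq A ≤ _
  rw [hsq_eq]
  calc _ ≤ ∑ i : Fin d, ∑ j : Fin d, ‖A‖ ^ 2 := by
        refine Finset.sum_le_sum fun i _ => Finset.sum_le_sum fun j _ => ?_
        gcongr; exact Matrix.norm_entry_le_entrywise_sup_norm A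
    _ = _ := by simp; ring

theorem hsq_zero_iff {d : ℕ} (A : Matrix (Fin d) (Fin d) ℂ) : hsq A = 0 ↔ A = 0 := by
  constructor
  · intro h
    have := norm_le_hsNorm A
    change _ ≤ Real.sqrt (hsq A) at this
    rw [h] at this; simpa using this
  · rintro rfl; simp [hsq]

theorem hsq_cont {d : ℕ} : Continuous (hsq (d := d)) := by
  have : (hsq (d := d)) = fun A => ∑ i, ∑ j, ‖A j i‖ ^ 2 := by ext; exact hsq_eq _
  rw [this]
  fun_prop

theorem le_opNorm2 {d : ℕ} (Φ : Matrix (Fin d) (Fin d) ℂ →ₗ[ℂ] Matrix (Fin d) (Fin d) ℂ)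
    (A : Matrix (Fin d) (Fin d) ℂ) : ‖Φ A‖ ≤ opNorm2 Φ * (d * ‖A‖) := by
  have hbdd : BddAbove {r : ℝ | ∃ A, hsNorm A = 1 ∧ r = hsNorm (Φ A)} := by
    refine ⟨d * (∑ i, ∑ j, 1 * ‖Φ (Matrix.single i j 1)‖), ?_⟩
    rintro r ⟨A, hA, rfl⟩
    refine (hsNorm_le _).trans ?_
    gcongr
    have hA1 : ‖A‖ ≤ 1 := by rw [← hA]; exact norm_le_hsNorm A
    have e : Φ A = ∑ i, ∑ j, A i j • Φ (Matrix.single i j 1) := by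
      conv_lhs => rw [Matrix.matrix_eq_sum_single A]
      simp only [map_sum, ← map_smul, Matrix.smul_single, smul_eq_mul, mul_one]
    rw [e]
    refine (norm_sum_le _ _).trans (Finset.sum_le_sum fun i _ => ?_)
    refine (norm_sum_le _ _).trans (Finset.sum_le_sum fun j _ => ?_)
    rw [norm_smul]
    gcongr
    exact (Matrix.norm_entry_le_entrywise_sup_norm A).trans hA1
  have h0 : 0 ≤ opNorm2 Φ := by
    apply Real.sSup_nonneg
    rintro r ⟨A, hA, rfl⟩
    exact Real.sqrt_nonneg _
  have hsmul : ∀ (c : ℝ) (B : Matrix (Fin d) (Fin d) ℂ), 0 ≤ c → hsNorm ((c : ℂ) • B) = c * hsNorm B := by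
    intro c B hc
    have : hsq ((c:ℂ) • B) = c ^ 2 * hsq B := by
      simp [hsq_eq, Finset.mul_sum, mul_pow]
    change √(hsq _) = c * √(hsq _)
    rw [this, Real.sqrt_mul (by positivity), Real.sqrt_sq hc]
  by_cases hA : hsNorm A = 0
  · have : A = 0 := by
      have := norm_le_hsNorm A
      rw [hA] at this; simpa using this
    simp [this]
  · have hpos : 0 < hsNorm A := lt_of_le_of_ne (Real.sqrt_nonneg _) (Ne.symm hA)
    have : hsNorm (Φ ((((hsNorm A)⁻¹ : ℝ) : ℂ) • A)) ≤ opNorm2 Φ := by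
      apply le_csSup hbdd
      exact ⟨_, by rw [hsmul _ _ (by positivity), inv_mul_cancel₀ hA], rfl⟩
    rw [map_smul, hsmul _ _ (by positivity), inv_mul_le_iff₀ hpos] at this
    calc ‖Φ A‖ ≤ hsNorm (Φ A) := norm_le_hsNorm _
      _ ≤ hsNorm A * opNorm2 Φ := this
      _ ≤ _ := by rw [mul_comm]; gcongr; exact hsNorm_le A

noncomputable def gkslLin {d M : ℕ} (H : ℝ → Matrix (Fin d) (Fin d) ℂ)
    (L : Fin M → ℝ → Matrix (Fin d) (Fin d) ℂ) (t : ℝ) :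
    Matrix (Fin d) (Fin d) ℂ →ₗ[ℂ] Matrix (Fin d) (Fin d) ℂ where
  toFun := gksl H L t
  map_add' A B := by
    simp only [gksl, mul_add, add_mul]
    rw [show ∀ a b c e : Matrix (Fin d) (Fin d) ℂ, a + b + (c + e) = (a + c) + (b + e) from
      fun a b c e => by abel, ← smul_add, ← Finset.sum_add_distrib]
    congr 1
    · congr 1; abel
    · refine Finset.sum_congr rfl fun m _ => ?_
      simp only [smul_add]; abel
  map_smul' c A := by
    simp only [gksl, smul_add, Finset.smul_sum, RingHom.id_apply, Matrix.mul_smul, Matrix.smul_mul, smul_sub, smul_comm c]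

theorem gksl_one {d M : ℕ} (H : ℝ → Matrix (Fin d) (Fin d) ℂ)
    (L : Fin M → ℝ → Matrix (Fin d) (Fin d) ℂ) (t : ℝ) : gksl H L t 1 = 0 := by
  simp only [gksl, mul_one, one_mul, sub_self, smul_zero, zero_add]
  refine Finset.sum_eq_zero fun m _ => ?_
  rw [← two_smul ℂ, smul_smul, ← pow_two]; simp

theorem gksl_trace {d M : ℕ} (H : ℝ → Matrix (Fin d) (Fin d) ℂ)
    (L : Fin M → ℝ → Matrix (Fin d) (Fin d) ℂ) (t : ℝ) (A : Matrix (Fin d) (Fin d) ℂ) :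
    Matrix.trace (gksl H L t A) = 0 := by
  simp only [gksl, Matrix.trace_add, Matrix.trace_smul, Matrix.trace_sub, Matrix.trace_sum,
    Matrix.trace_mul_comm A, sub_self, smul_zero, zero_add]
  refine Finset.sum_eq_zero fun m _ => ?_
  rw [Matrix.trace_mul_comm, ← mul_assoc, ← pow_two, ← two_mul]; simp

theorem gksl_comm {d M : ℕ} (H : ℝ → Matrix (Fin d) (Fin d) ℂ)
    (L : Fin M → ℝ → Matrix (Fin d) (Fin d) ℂ) (t : ℝ) (A : Matrix (Fin d) (Fin d) ℂ)
    (h : ∀ m, L m t * A = A * L m t) :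
    gksl H L t A = (-Complex.I) • (H t * A - A * H t) := by
  simp only [gksl]
  rw [Finset.sum_eq_zero, add_zero]
  intro m _
  have : L m t ^ 2 * A = A * L m t ^ 2 := by
    rw [pow_two, mul_assoc, h m, ← mul_assoc, h m, mul_assoc]
  rw [this, ← two_smul ℂ, smul_smul, h m, mul_assoc, ← pow_two]; simp

theorem gksl_diss {d M : ℕ} (H : ℝ → Matrix (Fin d) (Fin d) ℂ)
    (L : Fin M → ℝ → Matrix (Fin d) (Fin d) ℂ) (t : ℝ)
    (hH : (H t).IsHermitian) (hL : ∀ m, (L m t).IsHermitian) (A : Matrix (Fin d) (Fin d) ℂ) :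
    (Matrix.trace ((gksl H L t A)ᴴ * A + Aᴴ * gksl H L t A)).re = - ∑ m, hsq (L m t * A - A * L m t) := by
  have key : Matrix.trace ((gksl H L t A)ᴴ * A + Aᴴ * gksl H L t A) =
      - ∑ m, Matrix.trace ((L m t * A - A * L m t)ᴴ * (L m t * A - A * L m t)) := by
    have hLs : ∀ m, (L m t)ᴴ = L m t := hL
    have hHs : (H t)ᴴ = H t := hH
    have e1 : Matrix.trace (((-Complex.I) • (H t * A - A * H t))ᴴ * A + Aᴴ * ((-Complex.I) • (H t * A - A * H t))) = 0 := by
      simp only [Matrix.conjTranspose_smul, Matrix.conjTranspose_sub, Matrix.conjTranspose_mul, hHs,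
        Matrix.smul_mul, Matrix.mul_smul, sub_mul, mul_sub, Matrix.trace_add, Matrix.trace_smul,
        Matrix.trace_sub]
      have a1 : Matrix.trace (H t * Aᴴ * A) = Matrix.trace (Aᴴ * (A * H t)) := by
        rw [mul_assoc, Matrix.trace_mul_comm, mul_assoc]
      have a2 : Matrix.trace (Aᴴ * H t * A) = Matrix.trace (Aᴴ * (H t * A)) := by rw [mul_assoc]
      rw [a1, a2]; simp
    have e2 : ∀ m, Matrix.trace ((L m t * A * L m t - (2⁻¹ : ℂ) • ((L m t) ^ 2 * A + A * (L m t) ^ 2))ᴴ * A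
        + Aᴴ * (L m t * A * L m t - (2⁻¹ : ℂ) • ((L m t) ^ 2 * A + A * (L m t) ^ 2))) =
        - Matrix.trace ((L m t * A - A * L m t)ᴴ * (L m t * A - A * L m t)) := by
      intro m
      simp only [Matrix.conjTranspose_smul, Matrix.conjTranspose_sub, Matrix.conjTranspose_add,
        Matrix.conjTranspose_mul, hLs, pow_two,
        Matrix.smul_mul, Matrix.mul_smul, sub_mul, mul_sub, add_mul, mul_add, Matrix.trace_add, Matrix.trace_smul,
        Matrix.trace_sub, ← mul_assoc]
      have a1 : Matrix.trace (L m t * L m t * Aᴴ * A) = Matrix.trace (Aᴴ * A * L m t * L m t) := by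
        rw [mul_assoc, Matrix.trace_mul_comm, ← mul_assoc]
      have a2 : Matrix.trace (L m t * Aᴴ * L m t * A) = Matrix.trace (Aᴴ * L m t * A * L m t) := by
        rw [mul_assoc, mul_assoc, Matrix.trace_mul_comm, ← mul_assoc]
      have a3 : Matrix.trace (L m t * Aᴴ * A * L m t) = Matrix.trace (Aᴴ * A * L m t * L m t) := by
        rw [mul_assoc, mul_assoc, Matrix.trace_mul_comm, ← mul_assoc]
      rw [a1, a2, a3]; simp; ring
    simp only [gksl]
    rw [Matrix.conjTranspose_add, add_mul, mul_add, add_add_add_comm, Matrix.trace_add, e1, zero_add,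
      Matrix.conjTranspose_sum, Finset.sum_mul, Finset.mul_sum, ← Finset.sum_add_distrib, Matrix.trace_sum,
      ← Finset.sum_neg_distrib]
    exact Finset.sum_congr rfl fun m _ => e2 m
  rw [key]; simp [hsq]

theorem hd_hsq {d : ℕ} {f : ℝ → Matrix (Fin d) (Fin d) ℂ} {fD : Matrix (Fin d) (Fin d) ℂ} {t : ℝ}
    (hf : HasDerivAt f fD t) :
    HasDerivAt (fun s => hsq (f s)) (Matrix.trace (fDᴴ * f t + (f t)ᴴ * fD)).re t := by
  have := hd_tr (hd_mul (hd_ct hf) hf)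
  exact (Complex.reCLM.hasFDerivAt.comp_hasDerivAt t this)

theorem limit_traj {E : Type*} [NormedAddCommGroup E] [NormedSpace ℝ E] [ProperSpace E]
    (G : ℝ → E → E) (K B : ℝ) (hK : 0 < K) (hB : 0 ≤ B)
    (hGs : ∀ t, 0 ≤ t → ∀ v w, ‖G t v - G t w‖ ≤ K * ‖v - w‖)
    (hQ : ∀ ε > (0:ℝ), ∀ T > (0:ℝ), ∀ N : ℝ, ∃ s, N ≤ s ∧ 0 ≤ s ∧ ∀ t ∈ Set.Icc 0 T, ∀ v,
      ‖G (s + t) v - G t v‖ ≤ ε * ‖v‖)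
    (x : ℝ → E) (hx : ∀ t, 0 ≤ t → HasDerivAt x (G t (x t)) t)
    (hxB : ∀ t, 0 ≤ t → ‖x t‖ ≤ B) :
    ∃ (y : ℝ → E) (σ : ℕ → ℝ), Tendsto σ atTop atTop ∧
      (∀ t, 0 ≤ t → Tendsto (fun n => x (σ n + t)) atTop (nhds (y t))) ∧
      (∀ t, 0 < t → HasDerivAt y (G t (y t)) t) ∧ ContinuousOn y (Set.Ici 0) := by
  have h1 : ∀ n : ℕ, ∃ s, (n:ℝ) ≤ s ∧ 0 ≤ s ∧ ∀ t ∈ Set.Icc 0 ((n:ℝ)+1), ∀ v,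
      ‖G (s + t) v - G t v‖ ≤ (1 / ((n:ℝ)+1)) * ‖v‖ := fun n =>
    hQ _ (by positivity) _ (by positivity) _
  choose s hsn hs0 hs using h1
  obtain ⟨a, -, φ, hφ, ha⟩ := tendsto_subseq_of_bounded (s := Metric.closedBall (0:E) B)
    Metric.isBounded_closedBall (x := fun n => x (s n)) (fun n => by simpa using hxB _ (hs0 n))
  set σ : ℕ → ℝ := fun n => s (φ n) with hσ
  have hσ0 : ∀ n, 0 ≤ σ n := fun n => hs0 _
  set w : ℕ → ℝ → E := fun n t => x (σ n + t) with hw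
  have hσt : Tendsto σ atTop atTop :=
    tendsto_atTop_mono (fun n => hsn (φ n)) (tendsto_natCast_atTop_atTop.comp hφ.tendsto_atTop)
  set e : ℕ → ℝ := fun n => (1 / ((φ n:ℝ)+1)) * B with he
  have hpos : ∀ n, 0 ≤ e n := fun n => by positivity
  have het : Tendsto e atTop (nhds 0) := by
    have : Tendsto (fun n => (1 / ((φ n:ℝ)+1))) atTop (nhds 0) :=
      tendsto_one_div_add_atTop_nhds_zero_nat.comp hφ.tendsto_atTop
    have h2 := this.mul_const B
    rw [zero_mul] at h2
    exact h2
  have hwd : ∀ n t, 0 ≤ t → HasDerivAt (w n) (G (σ n + t) (w n t)) t := by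
    intro n t ht
    have := (hx (σ n + t) (add_nonneg (hσ0 n) ht))
    exact this.comp_const_add _ _
  have hne : ∀ (n : ℕ) (t : ℝ), 0 ≤ t → t ≤ n → ‖G (σ n + t) (w n t) - G t (w n t)‖ ≤ e n := by
    intro n t ht htn
    have hφn : (n:ℝ) ≤ φ n := by exact_mod_cast hφ.id_le n
    refine (hs (φ n) t ⟨ht, by linarith⟩ _).trans ?_
    refine mul_le_mul_of_nonneg_left ?_ (by positivity)
    exact hxB _ (add_nonneg (hσ0 n) ht)
  -- Gronwall comparison
  have hgr : ∀ T : ℝ, 0 ≤ T → ∀ n m : ℕ, T ≤ n → T ≤ m → ∀ t ∈ Set.Icc 0 T,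
      ‖w n t - w m t‖ ≤ (‖w n 0 - w m 0‖ + (e n + e m) / K) * Real.exp (K * T) := by
    intro T hT n m hn hm t ht
    have := norm_le_gronwallBound_of_norm_deriv_right_le (f := fun t => w n t - w m t)
      (f' := fun t => G (σ n + t) (w n t) - G (σ m + t) (w m t)) (δ := ‖w n 0 - w m 0‖) (K := K)
      (ε := e n + e m) (a := 0) (b := T)
      (fun t ht => ((hwd n t ht.1).sub (hwd m t ht.1)).continuousAt.continuousWithinAt)
      (fun t ht => ((hwd n t ht.1).sub (hwd m t ht.1)).hasDerivWithinAt)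
      le_rfl (by
        intro t ht
        have a1 := hne n t ht.1 (ht.2.le.trans hn)
        have a2 := hne m t ht.1 (ht.2.le.trans hm)
        have a3 := hGs t ht.1 (w n t) (w m t)
        have : G (σ n + t) (w n t) - G (σ m + t) (w m t) = (G (σ n + t) (w n t) - G t (w n t))
          - (G (σ m + t) (w m t) - G t (w m t)) + (G t (w n t) - G t (w m t)) := by abel
        rw [this]
        refine (norm_add_le _ _).trans ?_
        have := norm_sub_le (G (σ n + t) (w n t) - G t (w n t)) (G (σ m + t) (w m t) - G t (w m t))
        linarith) t ht
    refine this.trans ?_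
    rw [gronwallBound_of_K_ne_0 hK.ne']
    have h1 : Real.exp (K * (t - 0)) ≤ Real.exp (K * T) := by
      apply Real.exp_le_exp.2; rw [sub_zero]; exact mul_le_mul_of_nonneg_left ht.2 hK.le
    have h2 : 0 ≤ (e n + e m) / K := div_nonneg (add_nonneg (hpos n) (hpos m)) hK.le
    have h3 := norm_nonneg (w n 0 - w m 0)
    simp only
    nlinarith [mul_le_mul_of_nonneg_left h1 h2, mul_le_mul_of_nonneg_left h1 h3]
  have hw0 : Tendsto (fun n => w n 0) atTop (nhds a) := by
    simp only [hw, hσ, add_zero]; exact ha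
  have hUC : ∀ T : ℝ, 0 ≤ T → UniformCauchySeqOn w atTop (Set.Icc 0 T) := by
    intro T hT
    rw [Metric.uniformCauchySeqOn_iff]
    intro ε hε
    have hlim : Tendsto (fun p : ℕ × ℕ => (‖w p.1 0 - w p.2 0‖ + (e p.1 + e p.2) / K) * Real.exp (K * T))
        (atTop ×ˢ atTop) (nhds 0) := by
      have t1 : Tendsto (fun p : ℕ × ℕ => ‖w p.1 0 - w p.2 0‖) (atTop ×ˢ atTop) (nhds ‖a - a‖) :=
        ((hw0.comp tendsto_fst).sub (hw0.comp tendsto_snd)).norm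
      have t2 : Tendsto (fun p : ℕ × ℕ => (e p.1 + e p.2) / K) (atTop ×ˢ atTop) (nhds ((0 + 0) / K)) :=
        ((het.comp tendsto_fst).add (het.comp tendsto_snd)).div_const K
      simpa using (t1.add t2).mul_const (Real.exp (K * T))
    have hev := hlim.eventually (gt_mem_nhds hε)
    rw [prod_atTop_atTop_eq, eventually_atTop] at hev
    obtain ⟨⟨N1, N2⟩, hN⟩ := hev
    obtain ⟨N3, hN3⟩ := exists_nat_ge T
    refine ⟨max (max N1 N2) N3, fun m hm n hn t ht => ?_⟩
    rw [dist_eq_norm]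
    have c1 : ∀ k : ℕ, max (max N1 N2) N3 ≤ k → T ≤ k := fun k hk =>
      hN3.trans (by exact_mod_cast (le_max_right _ _).trans hk)
    refine (hgr T hT m n (c1 m hm) (c1 n hn) t ht).trans_lt (hN (m, n) ⟨?_, ?_⟩)
    · exact (le_max_left _ _).trans ((le_max_left _ _).trans hm)
    · exact (le_max_right _ _).trans ((le_max_left _ _).trans hn)
  have hex : ∀ t : ℝ, ∃ z, 0 ≤ t → Tendsto (fun n => w n t) atTop (nhds z) := by
    intro t
    by_cases ht : 0 ≤ t
    · obtain ⟨z, hz⟩ := cauchySeq_tendsto_of_complete ((hUC t ht).cauchySeq ⟨ht, le_rfl⟩)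
      exact ⟨z, fun _ => hz⟩
    · exact ⟨0, fun h => absurd h ht⟩
  choose y hy using hex
  have hTU : ∀ T : ℝ, 0 ≤ T → TendstoUniformlyOn w y atTop (Set.Icc 0 T) := fun T hT =>
    (hUC T hT).tendstoUniformlyOn_of_tendsto fun t ht => hy t ht.1
  refine ⟨y, σ, hσt, fun t ht => hy t ht, ?_, ?_⟩
  · intro t ht
    have hT : (0:ℝ) ≤ t + 1 := by linarith
    refine hasDerivAt_of_tendstoUniformlyOn (l := atTop) (s := Set.Ioo 0 (t+1)) (f := w)
      (f' := fun n t => G (σ n + t) (w n t)) (g' := fun t => G t (y t)) isOpen_Ioo ?_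
      (Eventually.of_forall fun n r hr => hwd n r hr.1.le) (fun r hr => hy r hr.1.le) ⟨ht, by linarith⟩
    rw [Metric.tendstoUniformlyOn_iff]
    intro ε hε
    have hu := Metric.tendstoUniformlyOn_iff.1 (hTU _ hT) (ε / (2 * K)) (by positivity)
    have he2 := het.eventually (gt_mem_nhds (half_pos hε))
    obtain ⟨N3, hN3⟩ := exists_nat_ge (t+1)
    filter_upwards [hu, he2, eventually_ge_atTop N3] with n hn1 hn2 hn3 r hr
    have b1 := hn1 r ⟨hr.1.le, hr.2.le⟩
    have b2 := hne n r hr.1.le (hr.2.le.trans (hN3.trans (by exact_mod_cast hn3)))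
    have b3 := hGs r hr.1.le (w n r) (y r)
    rw [dist_comm, dist_eq_norm] at b1 ⊢
    have b4 : K * ‖w n r - y r‖ < ε / 2 := by
      rw [lt_div_iff₀ (by positivity)] at b1; linarith
    have := norm_add_le (G (σ n + r) (w n r) - G r (w n r)) (G r (w n r) - G r (y r))
    rw [sub_add_sub_cancel] at this
    linarith
  · intro t ht
    have hT : (0:ℝ) ≤ t + 1 := by have : 0 ≤ t := ht; linarith
    have hc : ContinuousOn y (Set.Icc 0 (t+1)) := by
      refine (hTU _ hT).continuousOn (Frequently.of_forall fun n r hr => ?_)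
      exact (hwd n r hr.1).continuousAt.continuousWithinAt
    have := hc t ⟨ht, by linarith⟩
    refine this.mono_of_mem_nhdsWithin ?_
    rw [mem_nhdsWithin]
    exact ⟨Set.Iio (t+1), isOpen_Iio, by simp, fun r hr => ⟨hr.2, hr.1.le⟩⟩

theorem const_of_deriv {E : Type*} [NormedAddCommGroup E] [NormedSpace ℝ E] (f : ℝ → E)
    (hc : ContinuousWithinAt f (Set.Ici 0) 0) (hf : ∀ t, 0 < t → HasDerivAt f 0 t) :
    ∀ t, 0 ≤ t → f t = f 0 := by
  intro t ht
  rcases ht.eq_or_lt with rfl | ht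
  · rfl
  have h1 : ∀ a, 0 < a → a ≤ t → f t = f a := fun a ha hat =>
    constant_of_has_deriv_right_zero (a := a) (b := t)
      (fun r hr => (hf r (ha.trans_le hr.1)).continuousAt.continuousWithinAt)
      (fun r hr => (hf r (ha.trans_le hr.1)).hasDerivWithinAt) t ⟨hat, le_rfl⟩
  have h2 : Tendsto f (nhdsWithin 0 (Set.Ioi 0)) (nhds (f 0)) := hc.mono Set.Ioi_subset_Ici_self
  have h3 : Tendsto f (nhdsWithin 0 (Set.Ioi 0)) (nhds (f t)) := by
    refine tendsto_const_nhds.congr' ?_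
    filter_upwards [Ioc_mem_nhdsGT ht] with a ha using h1 a ha.1 ha.2
  exact tendsto_nhds_unique h3 h2

theorem U_unitary {d : ℕ} (H : ℝ → Matrix (Fin d) (Fin d) ℂ)
    (hH : ∀ t : ℝ, 0 ≤ t → (H t).IsHermitian)
    (U : ℝ → Matrix (Fin d) (Fin d) ℂ)
    (hU0 : U 0 = 1)
    (hU : ∀ t : ℝ, 0 ≤ t → HasDerivAt U ((-Complex.I) • (H t * U t)) t) (t : ℝ) (ht : 0 ≤ t) :
    (U t)ᴴ * U t = 1 ∧ U t * (U t)ᴴ = 1 := by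
  have hd : ∀ t, 0 ≤ t → HasDerivAt (fun t => (U t)ᴴ * U t) 0 t := by
    intro t ht
    have := hd_mul (hd_ct (hU t ht)) (hU t ht)
    convert this using 1
    have h := hH t ht
    simp [Matrix.conjTranspose_smul, Matrix.conjTranspose_mul, h.eq, mul_assoc]
  have := const_of_deriv _ (hd 0 le_rfl).continuousAt.continuousWithinAt (fun t ht => hd t ht.le) t ht
  simp only [hU0, Matrix.conjTranspose_one, one_mul] at this
  exact ⟨this, mul_eq_one_comm.1 this⟩

theorem backward {d M : ℕ} (hd : 0 < d)
    (H : ℝ → Matrix (Fin d) (Fin d) ℂ)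
    (L : Fin M → ℝ → Matrix (Fin d) (Fin d) ℂ)
    (hH : ∀ t : ℝ, 0 ≤ t → (H t).IsHermitian)
    (hL : ∀ m, ∀ t : ℝ, 0 ≤ t → (L m t).IsHermitian)
    (U : ℝ → Matrix (Fin d) (Fin d) ℂ)
    (hU0 : U 0 = 1)
    (hU : ∀ t : ℝ, 0 ≤ t → HasDerivAt U ((-Complex.I) • (H t * U t)) t)
    (hconv : ∀ ρ0 : Matrix (Fin d) (Fin d) ℂ, IsDensity ρ0 →
      ∀ ρ : ℝ → Matrix (Fin d) (Fin d) ℂ, ρ 0 = ρ0 →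
        (∀ t : ℝ, 0 ≤ t → HasDerivAt ρ (gksl H L t (ρ t)) t) →
        Tendsto ρ atTop (nhds (((d : ℂ))⁻¹ • (1 : Matrix (Fin d) (Fin d) ℂ))))
    (O : Matrix (Fin d) (Fin d) ℂ)
    (hO : ∀ m, ∀ t : ℝ, 0 ≤ t → Commute ((U t)ᴴ * L m t * U t) O) :
    ∃ c : ℂ, O = c • (1 : Matrix (Fin d) (Fin d) ℂ) := by
  have hUU := U_unitary H hH U hU0 hU
  -- densities in the commutant are maximally mixed
  have key : ∀ ρ0 : Matrix (Fin d) (Fin d) ℂ, IsDensity ρ0 →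
      (∀ m, ∀ t : ℝ, 0 ≤ t → Commute ((U t)ᴴ * L m t * U t) ρ0) →
      ρ0 = ((d : ℂ))⁻¹ • (1 : Matrix (Fin d) (Fin d) ℂ) := by
    intro ρ0 hρ0 hcomm
    have hlim := hconv ρ0 hρ0 (fun t => U t * ρ0 * (U t)ᴴ) (by simp [hU0]) (by
      intro t ht
      have hc : ∀ m, L m t * (U t * ρ0 * (U t)ᴴ) = (U t * ρ0 * (U t)ᴴ) * L m t := by
        intro m
        have h := (hcomm m t ht).eq
        obtain ⟨u1, u2⟩ := hUU t ht
        calc L m t * (U t * ρ0 * (U t)ᴴ)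
            = (U t * (U t)ᴴ) * L m t * (U t * ρ0 * (U t)ᴴ) := by rw [u2, one_mul]
          _ = U t * ((U t)ᴴ * L m t * U t * ρ0) * (U t)ᴴ := by simp only [mul_assoc]
          _ = U t * ρ0 * (U t)ᴴ * L m t * (U t * (U t)ᴴ) := by rw [h]; simp only [mul_assoc]
          _ = _ := by rw [u2, mul_one]
      rw [gksl_comm H L t _ hc]
      have h1 := hd_mul (hd_mul (hU t ht) (hasDerivAt_const t ρ0)) (hd_ct (hU t ht))
      convert h1 using 1
      have h := hH t ht
      simp only [Matrix.conjTranspose_smul, Matrix.conjTranspose_mul, h.eq, mul_zero, add_zero,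
        Matrix.smul_mul, Matrix.mul_smul, smul_sub, mul_assoc]
      simp [sub_eq_add_neg])
    have h2 : Tendsto (fun t => hsq (U t * ρ0 * (U t)ᴴ - ((d : ℂ))⁻¹ • (1 : Matrix (Fin d) (Fin d) ℂ)))
        atTop (nhds 0) := by
      have h3 := (hsq_cont.tendsto _).comp (hlim.sub_const (((d : ℂ))⁻¹ • (1 : Matrix (Fin d) (Fin d) ℂ)))
      rw [sub_self, (hsq_zero_iff _).2 rfl] at h3
      exact h3
    have h4 : Tendsto (fun _ : ℝ => hsq (ρ0 - ((d : ℂ))⁻¹ • (1 : Matrix (Fin d) (Fin d) ℂ)))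
        atTop (nhds 0) := by
      refine h2.congr' ?_
      filter_upwards [eventually_ge_atTop 0] with t ht
      obtain ⟨u1, u2⟩ := hUU t ht
      set X := ρ0 - ((d : ℂ))⁻¹ • (1 : Matrix (Fin d) (Fin d) ℂ) with hX
      have e1 : U t * ρ0 * (U t)ᴴ - ((d : ℂ))⁻¹ • (1 : Matrix (Fin d) (Fin d) ℂ) = U t * X * (U t)ᴴ := by
        rw [hX, mul_sub, sub_mul, Matrix.mul_smul, mul_one, Matrix.smul_mul, u2]
      rw [e1, hsq, hsq]
      have e2 : (U t * X * (U t)ᴴ)ᴴ * (U t * X * (U t)ᴴ) = U t * (Xᴴ * X * (U t)ᴴ) := by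
        simp only [Matrix.conjTranspose_mul, Matrix.conjTranspose_conjTranspose]
        calc _ = U t * Xᴴ * ((U t)ᴴ * U t) * X * (U t)ᴴ := by simp only [mul_assoc]
          _ = _ := by rw [u1, mul_one]; simp only [mul_assoc]
      rw [e2, Matrix.trace_mul_comm, mul_assoc, u1, mul_one]
    have h5 := tendsto_nhds_unique h4 tendsto_const_nhds
    exact sub_eq_zero.1 ((hsq_zero_iff _).1 h5.symm)
  have hstar : ∀ A : Matrix (Fin d) (Fin d) ℂ,
      (∀ m, ∀ t : ℝ, 0 ≤ t → Commute ((U t)ᴴ * L m t * U t) A) →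
      (∀ m, ∀ t : ℝ, 0 ≤ t → Commute ((U t)ᴴ * L m t * U t) Aᴴ) := by
    intro A hA m t ht
    have h := congrArg Matrix.conjTranspose (hA m t ht).eq
    have hLm := hL m t ht
    simp only [Matrix.conjTranspose_mul, Matrix.conjTranspose_conjTranspose, hLm.eq] at h
    change _ = _
    simp only [mul_assoc] at h ⊢
    exact h.symm
  have hsc : ∀ A : Matrix (Fin d) (Fin d) ℂ,
      (∀ m, ∀ t : ℝ, 0 ≤ t → Commute ((U t)ᴴ * L m t * U t) A) →
      ∃ c : ℂ, Aᴴ * A = c • (1 : Matrix (Fin d) (Fin d) ℂ) := by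
    intro A hA
    by_cases h0 : Matrix.trace (Aᴴ * A) = 0
    · refine ⟨0, ?_⟩
      have : A = 0 := (hsq_zero_iff A).1 (by rw [hsq, h0]; rfl)
      simp [this]
    · have hps := Matrix.posSemidef_conjTranspose_mul_self A
      have hnn : 0 ≤ Matrix.trace (Aᴴ * A) := hps.trace_nonneg
      have := key ((Matrix.trace (Aᴴ * A))⁻¹ • (Aᴴ * A))
        ⟨hps.smul (inv_nonneg.2 hnn), by rw [Matrix.trace_smul, smul_eq_mul, inv_mul_cancel₀ h0]⟩
        (fun m t ht => ((hstar A hA m t ht).mul_right (hA m t ht)).smul_right _)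
      refine ⟨Matrix.trace (Aᴴ * A) * ((d : ℂ))⁻¹, ?_⟩
      rw [mul_smul, ← this, smul_smul, mul_inv_cancel₀ h0, one_smul]
  obtain ⟨c0, h0⟩ := hsc O hO
  obtain ⟨c1, h1⟩ := hsc (O + 1) (fun m t ht => (hO m t ht).add_right (Commute.one_right _))
  obtain ⟨c2, h2⟩ := hsc (O + Complex.I • 1)
    (fun m t ht => (hO m t ht).add_right ((Commute.one_right _).smul_right _))
  simp only [Matrix.conjTranspose_add, Matrix.conjTranspose_smul, Matrix.conjTranspose_one, add_mul, mul_add,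
    mul_one, one_mul, Matrix.smul_mul, Matrix.mul_smul, h0] at h1 h2
  refine ⟨2⁻¹ * ((c1 - c0 - 1) + Complex.I * (c2 - c0 - 1)), ?_⟩
  ext i j
  have e1 := congrFun (congrFun h1 i) j
  have e2 := congrFun (congrFun h2 i) j
  simp only [Matrix.add_apply, Matrix.smul_apply, smul_eq_mul] at e1 e2 ⊢
  simp only [Complex.star_def, Complex.conj_I] at e2
  have hI : Complex.I * Complex.I = -1 := Complex.I_mul_I
  linear_combination 2⁻¹ * e1 + 2⁻¹ * Complex.I * e2 + 2⁻¹ * (O i j + (1 : Matrix (Fin d) (Fin d) ℂ) i j * Complex.I - Oᴴ i j) * hI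

theorem tendsto_conj {d : ℕ} {l : Filter ℝ} {U y : ℝ → Matrix (Fin d) (Fin d) ℂ}
    {u v : Matrix (Fin d) (Fin d) ℂ} (hU : Tendsto U l (nhds u)) (hy : Tendsto y l (nhds v)) :
    Tendsto (fun t => (U t)ᴴ * y t * U t) l (nhds (uᴴ * v * u)) := by
  have hcont : Continuous (fun p : Matrix (Fin d) (Fin d) ℂ × Matrix (Fin d) (Fin d) ℂ =>
    p.1ᴴ * p.2 * p.1) := by fun_prop
  have h := hcont.tendsto (u, v)
  have h2 := h.comp (hU.prodMk_nhds hy)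
  exact h2

set_option maxHeartbeats 1000000 in
theorem forward {d M : ℕ} (hd : 0 < d)
    (H : ℝ → Matrix (Fin d) (Fin d) ℂ)
    (L : Fin M → ℝ → Matrix (Fin d) (Fin d) ℂ)
    (hH : ∀ t : ℝ, 0 ≤ t → (H t).IsHermitian)
    (hL : ∀ m, ∀ t : ℝ, 0 ≤ t → (L m t).IsHermitian)
    (hQ : CondQ (gksl H L))
    (U : ℝ → Matrix (Fin d) (Fin d) ℂ)
    (hU0 : U 0 = 1)
    (hU : ∀ t : ℝ, 0 ≤ t → HasDerivAt U ((-Complex.I) • (H t * U t)) t)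
    (htriv : ∀ O : Matrix (Fin d) (Fin d) ℂ,
        (∀ m, ∀ t : ℝ, 0 ≤ t → Commute ((U t)ᴴ * L m t * U t) O) →
        ∃ c : ℂ, O = c • (1 : Matrix (Fin d) (Fin d) ℂ))
    (ρ0 : Matrix (Fin d) (Fin d) ℂ) (hρ0 : IsDensity ρ0)
    (ρ : ℝ → Matrix (Fin d) (Fin d) ℂ) (hρi : ρ 0 = ρ0)
    (hρ : ∀ t : ℝ, 0 ≤ t → HasDerivAt ρ (gksl H L t (ρ t)) t) :
    Tendsto ρ atTop (nhds (((d : ℂ))⁻¹ • (1 : Matrix (Fin d) (Fin d) ℂ))) := by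
  have hUU := U_unitary H hH U hU0 hU
  have hdR : (0:ℝ) < d := by exact_mod_cast hd
  have hdC : (d:ℂ) ≠ 0 := by exact_mod_cast hd.ne'
  obtain ⟨hQc, ⟨K0, hK0, hQb⟩, hQq⟩ := hQ
  -- bounds for the generator
  have hlin : ∀ t A, gksl H L t A = gkslLin H L t A := fun t A => rfl
  have hbd : ∀ t, 0 ≤ t → ∀ A B, ‖gksl H L t A - gksl H L t B‖ ≤ (K0 * d) * ‖A - B‖ := by
    intro t ht A B
    rw [hlin, hlin, ← map_sub]
    refine (le_opNorm2 (gkslLin H L t) _).trans ?_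
    rw [← mul_assoc]
    gcongr
    exact hQb t ht
  have hdiff : ∀ s t ε, opNorm2 (fun A => gksl H L s A - gksl H L t A) < ε → ∀ A,
      ‖gksl H L s A - gksl H L t A‖ ≤ ε * (d * ‖A‖) := by
    intro s t ε h A
    have h1 := le_opNorm2 (gkslLin H L s - gkslLin H L t) A
    refine le_trans h1 ?_
    refine mul_le_mul_of_nonneg_right ?_ (by positivity)
    exact h.le
  have hq : ∀ ε > (0:ℝ), ∀ T > (0:ℝ), ∀ N : ℝ, ∃ s, N ≤ s ∧ 0 ≤ s ∧ ∀ t ∈ Set.Icc 0 T, ∀ v,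
      ‖gksl H L (s + t) v - gksl H L t v‖ ≤ ε * ‖v‖ := by
    intro ε hε T hT N
    obtain ⟨ts, h0, h1, h2⟩ := hQq (ε / d) (by positivity) T hT 0 le_rfl
    have h3 : ∀ n : ℕ, n * T ≤ ts n := by
      intro n
      induction n with
      | zero => simpa using h0 0
      | succ n ih => push_cast; linarith [h1 n]
    obtain ⟨n, hn⟩ := exists_nat_ge (N / T)
    refine ⟨ts n, ?_, h0 n, ?_⟩
    · exact ((div_le_iff₀ hT).1 hn).trans (h3 n)
    · intro t ht v
      have h4 := h2 n t ht
      rw [zero_add] at h4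
      refine (hdiff _ _ _ h4 v).trans (le_of_eq ?_)
      field_simp
  -- the deviation from the maximally mixed state
  set X : ℝ → Matrix (Fin d) (Fin d) ℂ := fun t => ρ t - ((d : ℂ))⁻¹ • (1 : Matrix (Fin d) (Fin d) ℂ) with hX
  have hXd : ∀ t, 0 ≤ t → HasDerivAt X (gksl H L t (X t)) t := by
    intro t ht
    have h1 := (hρ t ht).sub_const (((d : ℂ))⁻¹ • (1 : Matrix (Fin d) (Fin d) ℂ))
    have h2 : gksl H L t (X t) = gksl H L t (ρ t) := by
      rw [hlin, hX]
      simp only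
      rw [map_sub, map_smul, ← hlin t 1, gksl_one, smul_zero, sub_zero, hlin]
    rw [h2]; exact h1
  have hXtr : ∀ t, 0 ≤ t → Matrix.trace (X t) = 0 := by
    have h1 : ∀ t, 0 ≤ t → HasDerivAt (fun t => Matrix.trace (X t)) 0 t := by
      intro t ht
      have := hd_tr (hXd t ht)
      rwa [gksl_trace] at this
    intro t ht
    rw [const_of_deriv _ (h1 0 le_rfl).continuousAt.continuousWithinAt (fun t ht => h1 t ht.le) t ht]
    simp only [hX, hρi, Matrix.trace_sub, hρ0.2, Matrix.trace_smul, Matrix.trace_one, Fintype.card_fin]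
    rw [smul_eq_mul, inv_mul_cancel₀ hdC, sub_self]
  have hNd : ∀ t, 0 ≤ t → HasDerivAt (fun t => hsq (X t)) (- ∑ m, hsq (L m t * X t - X t * L m t)) t := by
    intro t ht
    have := hd_hsq (hXd t ht)
    rwa [gksl_diss H L t (hH t ht) (fun m => hL m t ht)] at this
  have hanti : AntitoneOn (fun t => hsq (X t)) (Set.Ici 0) := by
    refine antitoneOn_of_deriv_nonpos (convex_Ici 0)
      (fun t ht => (hNd t ht).continuousAt.continuousWithinAt) ?_ ?_
    · intro t ht
      rw [interior_Ici] at ht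
      exact (hNd t (le_of_lt ht)).differentiableAt.differentiableWithinAt
    · intro t ht
      rw [interior_Ici] at ht
      rw [(hNd t (le_of_lt ht)).deriv]
      exact neg_nonpos.2 (Finset.sum_nonneg fun m _ => hsq_nonneg _)
  have hanti2 : Antitone (fun t => hsq (X (max t 0))) := fun a b hab =>
    hanti (Set.mem_Ici.2 (le_max_right _ _)) (Set.mem_Ici.2 (le_max_right _ _)) (max_le_max_right 0 hab)
  obtain ⟨r, hr⟩ : ∃ r, Tendsto (fun t => hsq (X t)) atTop (nhds r) := by
    refine ⟨_, (tendsto_atTop_ciInf hanti2 ⟨0, ?_⟩).congr' ?_⟩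
    · rintro _ ⟨t, rfl⟩; exact hsq_nonneg _
    · filter_upwards [eventually_ge_atTop 0] with t ht
      rw [max_eq_left ht]
  have hXB : ∀ t, 0 ≤ t → ‖X t‖ ≤ Real.sqrt (hsq (X 0)) := fun t ht =>
    (norm_le_hsNorm _).trans (Real.sqrt_le_sqrt (hanti (Set.mem_Ici.2 le_rfl) ht ht))
  have : ProperSpace (Matrix (Fin d) (Fin d) ℂ) := inferInstanceAs (ProperSpace (Fin d → Fin d → ℂ))
  obtain ⟨y, σ, hσ, hyl, hyd, hyc⟩ := limit_traj (gksl H L) (K0 * d) _ (by positivity) (Real.sqrt_nonneg _)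
    hbd hq X hXd hXB
  have hyr : ∀ t, 0 ≤ t → hsq (y t) = r := by
    intro t ht
    have h1 := (hsq_cont.tendsto _).comp (hyl t ht)
    have h2 := hr.comp (tendsto_atTop_add_const_right _ t hσ)
    exact tendsto_nhds_unique h1 h2
  have hD : ∀ t, 0 < t → (Matrix.trace ((gksl H L t (y t))ᴴ * y t + (y t)ᴴ * gksl H L t (y t))).re = 0 := by
    intro t ht
    have h1 := hd_hsq (hyd t ht)
    have h2 : HasDerivAt (fun s => hsq (y s)) 0 t := by
      refine (hasDerivAt_const t r).congr_of_eventuallyEq ?_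
      filter_upwards [lt_mem_nhds ht] with s hs using hyr s hs.le
    exact h1.unique h2
  have hD0 : (Matrix.trace ((gksl H L 0 (y 0))ᴴ * y 0 + (y 0)ᴴ * gksl H L 0 (y 0))).re = 0 := by
    have hy0 : Tendsto y (nhdsWithin 0 (Set.Ioi 0)) (nhds (y 0)) :=
      (hyc 0 (Set.mem_Ici.2 le_rfl)).mono Set.Ioi_subset_Ici_self
    have hg0 : Tendsto (fun t => gksl H L t (y t)) (nhdsWithin 0 (Set.Ioi 0)) (nhds (gksl H L 0 (y 0))) := by
      have hg1 : Tendsto (fun t => gksl H L t (y 0)) (nhdsWithin 0 (Set.Ioi 0)) (nhds (gksl H L 0 (y 0))) := by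
        refine Metric.tendsto_nhdsWithin_nhds.2 ?_
        intro ε hε
        obtain ⟨δ, hδ, h⟩ := hQc 0 le_rfl (ε / (2 * (d * ‖y 0‖ + 1))) (by positivity)
        refine ⟨δ, hδ, fun {t} ht hdt => ?_⟩
        rw [Real.dist_eq] at hdt
        rw [dist_eq_norm]
        refine (hdiff _ _ _ (h t (le_of_lt ht) hdt) (y 0)).trans_lt ?_
        rw [div_mul_eq_mul_div, div_lt_iff₀ (by positivity)]
        have : 0 ≤ d * ‖y 0‖ := by positivity
        nlinarith [mul_nonneg hε.le this]
      have hg2 : Tendsto (fun t => gksl H L t (y t) - gksl H L t (y 0)) (nhdsWithin 0 (Set.Ioi 0)) (nhds 0) := by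
        have h3 : Tendsto (fun t => (K0 * d) * ‖y t - y 0‖) (nhdsWithin 0 (Set.Ioi 0)) (nhds 0) := by
          have h4 := (hy0.sub_const (y 0)).norm.const_mul (K0 * d)
          rwa [sub_self, norm_zero, mul_zero] at h4
        refine squeeze_zero_norm' ?_ h3
        filter_upwards [self_mem_nhdsWithin] with t ht using hbd t (le_of_lt ht) _ _
      have := hg2.add hg1
      simpa using this
    have hcont : Continuous (fun p : Matrix (Fin d) (Fin d) ℂ × Matrix (Fin d) (Fin d) ℂ =>
        (Matrix.trace (p.1ᴴ * p.2 + p.2ᴴ * p.1)).re) := by fun_prop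
    have h5 := (hcont.tendsto (gksl H L 0 (y 0), y 0)).comp (hg0.prodMk_nhds hy0)
    refine tendsto_nhds_unique h5 (tendsto_const_nhds.congr' ?_)
    filter_upwards [self_mem_nhdsWithin] with t ht using (hD t ht).symm
  have hcom : ∀ t, 0 ≤ t → ∀ m, L m t * y t = y t * L m t := by
    intro t ht m
    have h1 : (Matrix.trace ((gksl H L t (y t))ᴴ * y t + (y t)ᴴ * gksl H L t (y t))).re = 0 := by
      rcases ht.eq_or_lt with rfl | h
      · exact hD0
      · exact hD t h
    rw [gksl_diss H L t (hH t ht) (fun m => hL m t ht), neg_eq_zero,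
      Finset.sum_eq_zero_iff_of_nonneg (fun m _ => hsq_nonneg _)] at h1
    exact sub_eq_zero.1 ((hsq_zero_iff _).1 (h1 m (Finset.mem_univ m)))
  have hconst : ∀ t, 0 ≤ t → (U t)ᴴ * y t * U t = y 0 := by
    intro t ht
    have hA : ContinuousWithinAt (fun t => (U t)ᴴ * y t * U t) (Set.Ici 0) 0 := by
      have hUc : ContinuousWithinAt U (Set.Ici 0) 0 := (hU 0 le_rfl).continuousAt.continuousWithinAt
      have hyc0 := hyc 0 (Set.mem_Ici.2 le_rfl)
      exact tendsto_conj hUc hyc0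
    have hB : ∀ t, 0 < t → HasDerivAt (fun t => (U t)ᴴ * y t * U t) 0 t := by
      intro t ht
      have h2 := hyd t ht
      rw [gksl_comm H L t _ (hcom t ht.le)] at h2
      have h3 := hd_mul (hd_mul (hd_ct (hU t ht.le)) h2) (hU t ht.le)
      convert h3 using 1
      have h := hH t ht.le
      simp only [Matrix.conjTranspose_smul, Matrix.conjTranspose_mul, h.eq,
        Matrix.smul_mul, Matrix.mul_smul, smul_sub, mul_assoc, add_mul, mul_sub, sub_mul]
      simp
    have h1 := const_of_deriv _ hA hB t ht
    simpa [hU0] using h1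
  obtain ⟨c, hc⟩ := htriv (y 0) (by
    intro m t ht
    have h := hcom t ht m
    obtain ⟨u1, u2⟩ := hUU t ht
    change _ * _ = _ * _
    rw [← hconst t ht]
    calc (U t)ᴴ * L m t * U t * ((U t)ᴴ * y t * U t)
        = (U t)ᴴ * L m t * (U t * (U t)ᴴ) * y t * U t := by simp only [mul_assoc]
      _ = (U t)ᴴ * (L m t * y t) * U t := by rw [u2, mul_one]; simp only [mul_assoc]
      _ = (U t)ᴴ * y t * (U t * (U t)ᴴ) * L m t * U t := by rw [h, u2, mul_one]; simp only [mul_assoc]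
      _ = _ := by simp only [mul_assoc])
  have hytr : Matrix.trace (y 0) = 0 := by
    have hcont : Continuous (fun A : Matrix (Fin d) (Fin d) ℂ => Matrix.trace A) := by fun_prop
    have h1 := (hcont.tendsto _).comp (hyl 0 le_rfl)
    refine tendsto_nhds_unique h1 (tendsto_const_nhds.congr' ?_)
    filter_upwards [hσ.eventually_ge_atTop 0] with n hn
    simp only [Function.comp]
    rw [hXtr _ (by linarith)]
  have hc0 : c = 0 := by
    rw [hc, Matrix.trace_smul, Matrix.trace_one, Fintype.card_fin, smul_eq_mul] at hytr
    exact (mul_eq_zero.1 hytr).resolve_right hdC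
  have hr0 : r = 0 := by
    rw [← hyr 0 le_rfl, hsq_zero_iff, hc, hc0, zero_smul]
  rw [hr0] at hr
  have hX0 : Tendsto X atTop (nhds 0) := by
    have h1 : Tendsto (fun t => Real.sqrt (hsq (X t))) atTop (nhds 0) := by
      have h2 := (Real.continuous_sqrt.tendsto 0).comp hr
      rw [Real.sqrt_zero] at h2
      exact h2
    exact squeeze_zero_norm (fun t => norm_le_hsNorm (X t)) h1
  have := hX0.add_const (((d : ℂ))⁻¹ • (1 : Matrix (Fin d) (Fin d) ℂ))
  simpa [hX] using this


/-- For a time-quasiperiodic GKSL generator with Hermitian jump operators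
(Condition Q), triviality of the interaction-picture strong symmetry `C^Int` is
equivalent to every solution converging to the maximally mixed state `I/d`. -/
theorem stmt0 {d M : ℕ} (hd : 0 < d)
    (H : ℝ → Matrix (Fin d) (Fin d) ℂ)
    (L : Fin M → ℝ → Matrix (Fin d) (Fin d) ℂ)
    (hH : ∀ t : ℝ, 0 ≤ t → (H t).IsHermitian)
    (hL : ∀ m, ∀ t : ℝ, 0 ≤ t → (L m t).IsHermitian)
    (hHcont : Continuous H)
    (hQ : CondQ (gksl H L))
    (U : ℝ → Matrix (Fin d) (Fin d) ℂ)
    (hU0 : U 0 = 1)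
    (hU : ∀ t : ℝ, 0 ≤ t → HasDerivAt U ((-Complex.I) • (H t * U t)) t) :
    (∀ O : Matrix (Fin d) (Fin d) ℂ,
        (∀ m, ∀ t : ℝ, 0 ≤ t → Commute ((U t)ᴴ * L m t * U t) O) →
        ∃ c : ℂ, O = c • (1 : Matrix (Fin d) (Fin d) ℂ))
      ↔
    (∀ ρ0 : Matrix (Fin d) (Fin d) ℂ, IsDensity ρ0 →
      ∀ ρ : ℝ → Matrix (Fin d) (Fin d) ℂ, ρ 0 = ρ0 →
        (∀ t : ℝ, 0 ≤ t → HasDerivAt ρ (gksl H L t (ρ t)) t) →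
        Tendsto ρ atTop (nhds (((d : ℂ))⁻¹ • (1 : Matrix (Fin d) (Fin d) ℂ)))) := by
  exact ⟨fun h ρ0 hρ0 ρ hρi hρ => forward hd H L hH hL hQ U hU0 hU h ρ0 hρ0 ρ hρi hρ,
    fun h O hO => backward hd H L hH hL U hU0 hU h O hO⟩
end

section
/- Let L_t be a time-dependent GKSL generator with Hermitian jump operators satisfying Condition Q, and assume that t ↦ H_t and t ↦ L_{m,t} are real-analytic on [0,∞) for every m. If for every density matrix ρ0 every solution ρ_t with ρ_0 = ρ0 satisfies lim_{t→∞} ρ_t = I/d, then there exists t0 ≥ 0 such that A^ad_{t0} equals the full matrix algebra of d×d complex matrices. -/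
open Matrix Filter
open scoped ComplexOrder

attribute [local instance] Matrix.normedAddCommGroup Matrix.normedSpace

noncomputable def hsNormSq {d : ℕ} (A : Matrix (Fin d) (Fin d) ℂ) : ℝ :=
  (Matrix.trace (Aᴴ * A)).re

noncomputable def opNorm2' {d : ℕ}
    (Φ : Matrix (Fin d) (Fin d) ℂ → Matrix (Fin d) (Fin d) ℂ) : ℝ :=
  sSup {r : ℝ | ∃ A, hsNorm A = 1 ∧ Matrix.trace A = 0 ∧ r = hsNorm (Φ A)}

/-- The adjoint operation on a time-dependent family of matrices:
`ad(A)_t = i[H_t, A_t] + ∂_t A_t`. -/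
noncomputable def adOp {d : ℕ} (H : ℝ → Matrix (Fin d) (Fin d) ℂ)
    (A : ℝ → Matrix (Fin d) (Fin d) ℂ) : ℝ → Matrix (Fin d) (Fin d) ℂ :=
  fun t => Complex.I • (H t * A t - A t * H t) + deriv A t

/-- `n`-fold application of the adjoint operation to a family of matrices. -/
noncomputable def adPow {d : ℕ} (H : ℝ → Matrix (Fin d) (Fin d) ℂ) :
    ℕ → (ℝ → Matrix (Fin d) (Fin d) ℂ) → (ℝ → Matrix (Fin d) (Fin d) ℂ)
  | 0, A => A
  | n + 1, A => adOp H (adPow H n A)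



theorem aux_burnside {d : ℕ} (hd : 0 < d) (s : Set (Matrix (Fin d) (Fin d) ℂ))
    (hs : ∀ A ∈ s, A.IsHermitian)
    (hP : ∀ P : Matrix (Fin d) (Fin d) ℂ, P.IsHermitian → P * P = P →
      (∀ A ∈ s, P * A = A * P) → P = 0 ∨ P = 1) :
    Algebra.adjoin ℂ s = ⊤ := by
  classical
  let E := EuclideanSpace ℂ (Fin d)
  let T := Matrix.toEuclideanCLM (n := Fin d) (𝕜 := ℂ)
  have : NeZero d := ⟨hd.ne'⟩
  have : Nontrivial E := inferInstance
  let R := Algebra.adjoin ℂ s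
  let φ : R →+* Module.End ℂ E :=
    { toFun := fun r => (T r.1).toLinearMap
      map_one' := by ext; simp
      map_mul' := by intro a b; ext; simp
      map_zero' := by ext; simp
      map_add' := by intro a b; ext; simp }
  let : Module R E := Module.compHom E φ
  have hsm : ∀ (r : R) (v : E), r • v = T r.1 v := fun r v => rfl
  have hscal : ∀ (c : ℂ) (v : E), (algebraMap ℂ R c) • v = c • v := by
    intro c v
    rw [hsm]
    simp [Algebra.algebraMap_eq_smul_one]
  have : IsSimpleModule R E := by
    refine { exists_pair_ne := ⟨⊥, ⊤, bot_ne_top⟩, eq_bot_or_eq_top := ?_ }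
    intro W
    let W' : Submodule ℂ E :=
      { carrier := W
        add_mem' := fun h1 h2 => W.add_mem h1 h2
        zero_mem' := W.zero_mem
        smul_mem' := fun c x hx => by
          have := W.smul_mem (algebraMap ℂ R c) hx
          exact (congrArg (· ∈ W) (hscal c x)).mp this }
    let p := W'.starProjection
    have hpH : IsSelfAdjoint p := isSelfAdjoint_starProjection W'
    have hp2 : p * p = p := W'.isIdempotentElem_starProjection
    have hinv : ∀ A ∈ s, ∀ v ∈ W', T A v ∈ W' := by
      intro A hA v hv
      exact W.smul_mem (⟨A, Algebra.subset_adjoin hA⟩ : R) hv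
    have hTA : ∀ A ∈ s, IsSelfAdjoint (T A) := by
      intro A hA
      have h1 : IsSelfAdjoint A := hs A hA
      exact h1.map T
    have hpp : ∀ A ∈ s, p * T A * p = T A * p := by
      intro A hA
      ext1 v
      exact Submodule.starProjection_eq_self_iff.2 (hinv A hA _ (Submodule.starProjection_apply_mem W' v))
    have hcomm : ∀ A ∈ s, p * T A = T A * p := by
      intro A hA
      have h1 := hpp A hA
      have h2 := congrArg star h1
      simp only [star_mul, hpH.star_eq, (hTA A hA).star_eq] at h2
      rw [← h2, ← mul_assoc, h1]
    have := hP (T.symm p) ?_ ?_ ?_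
    · rcases this with h | h
      · left
        have h' : p = 0 := by simpa using h
        rw [eq_bot_iff]
        intro v hv
        have : p v = v := Submodule.starProjection_eq_self_iff.2 hv
        rw [h'] at this
        exact this.symm
      · right
        have h' : p = 1 := by
          have := congrArg T h
          simpa using this
        rw [eq_top_iff]
        intro v _
        have : p v ∈ W' := Submodule.starProjection_apply_mem W' v
        rw [h'] at this
        exact this
    · have h1 : T (star (T.symm p)) = T (T.symm p) := by
        rw [map_star]
        have : T (T.symm p) = p := T.apply_symm_apply p
        rw [this, hpH.star_eq]
      exact T.injective h1
    · rw [← map_mul, hp2]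
    · intro A hA
      apply T.injective
      have e : T (T.symm p) = p := T.apply_symm_apply p
      change T (T.symm p * A) = T (A * T.symm p)
      rw [map_mul, map_mul, e]
      exact hcomm A hA
  have hlin : ∀ (f : Module.End R E) (c : ℂ) (v : E), f (c • v) = c • f v := by
    intro f c v
    rw [← hscal, map_smul, hscal]
  have hEnd : ∀ f : Module.End R E, ∃ c : ℂ, ∀ v, f v = c • v := by
    intro f
    let g : Module.End ℂ E := { toFun := f, map_add' := map_add f, map_smul' := hlin f }
    obtain ⟨c, hc⟩ := Module.End.exists_eigenvalue g
    obtain ⟨v, hv⟩ := hc.exists_hasEigenvector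
    refine ⟨c, ?_⟩
    let k : Module.End R E :=
      { toFun := fun v => f v - c • v
        map_add' := by intro a b; simp only [map_add, smul_add]; abel
        map_smul' := by
          intro r x
          change f (r • x) - c • (T r.1 x) = T r.1 (f x - c • x)
          rw [map_sub, (T r.1).map_smul]
          congr 1
          exact map_smul f r x }
    have hkv : k v = 0 := by
      have := hv.apply_eq_smul
      change f v - c • v = 0
      exact sub_eq_zero.2 this
    rcases k.bijective_or_eq_zero with hb | h0
    · exact absurd (hb.1 (hkv.trans (map_zero k).symm)) hv.2
    · intro x
      have : k x = 0 := by rw [h0]; rfl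
      exact sub_eq_zero.1 this
  rw [eq_top_iff]
  intro b _
  let F : Module.End (Module.End R E) E :=
    { toFun := fun v => T b v
      map_add' := map_add _
      map_smul' := by
        intro f x
        obtain ⟨c, hc⟩ := hEnd f
        simp only [Module.End.smul_def, hc, map_smul, RingHom.id_apply] }
  obtain ⟨r, hr⟩ := jacobson_density (R := R) F
    (Finset.univ.image (EuclideanSpace.basisFun (Fin d) ℂ))
  have : T b = T r.1 := by
    apply ContinuousLinearMap.coe_injective
    apply (EuclideanSpace.basisFun (Fin d) ℂ).toBasis.ext
    intro i
    have := hr (EuclideanSpace.basisFun (Fin d) ℂ i) (Finset.mem_image_of_mem _ (Finset.mem_univ i))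
    simpa using! this
  rw [T.injective this]
  exact r.2

/-- Recursive coefficients of the power series solution. -/
noncomputable def auxCoef {𝔸 : Type*} [NormedRing 𝔸] [NormedAlgebra ℝ 𝔸] (a : ℕ → 𝔸) : ℕ → 𝔸
  | 0 => 1
  | n + 1 => ((n : ℝ) + 1)⁻¹ • ∑ j : Fin (n + 1), a (n - j) * auxCoef a j

theorem auxCoef_bound {𝔸 : Type*} [NormedRing 𝔸] [NormedAlgebra ℝ 𝔸] (a : ℕ → 𝔸)
    (C r : ℝ) (hC : 0 < C) (hr : 0 < r) (ha : ∀ n, ‖a n‖ ≤ C * r ^ n) (n : ℕ) :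
    ‖auxCoef a n‖ ≤ ‖(1 : 𝔸)‖ * (C + r) ^ n := by
  induction n using Nat.strong_induction_on with
  | _ n ih =>
    cases n with
    | zero => simp [auxCoef]
    | succ n =>
      rw [auxCoef, norm_smul, Real.norm_eq_abs, abs_of_pos (by positivity)]
      have h1 : ‖∑ j : Fin (n + 1), a (n - j) * auxCoef a j‖ ≤
          ∑ j : Fin (n + 1), C * (‖(1 : 𝔸)‖ * (C + r) ^ n) := by
        refine norm_sum_le_of_le _ fun j _ => ?_
        have hj : (j : ℕ) ≤ n := Nat.lt_succ_iff.1 j.2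
        calc ‖a (n - j) * auxCoef a j‖ ≤ ‖a (n - j)‖ * ‖auxCoef a j‖ := norm_mul_le _ _
          _ ≤ (C * r ^ (n - j)) * (‖(1 : 𝔸)‖ * (C + r) ^ (j : ℕ)) := by
            gcongr
            · exact ha _
            · exact ih _ j.2
          _ ≤ (C * (C + r) ^ (n - j)) * (‖(1 : 𝔸)‖ * (C + r) ^ (j : ℕ)) := by
            gcongr
            linarith
          _ = C * (‖(1 : 𝔸)‖ * ((C + r) ^ (n - j) * (C + r) ^ (j : ℕ))) := by ring
          _ = C * (‖(1 : 𝔸)‖ * (C + r) ^ n) := by rw [← pow_add, Nat.sub_add_cancel hj]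
      calc ((n : ℝ) + 1)⁻¹ * ‖∑ j : Fin (n + 1), a (n - j) * auxCoef a j‖
          ≤ ((n : ℝ) + 1)⁻¹ * ∑ j : Fin (n + 1), C * (‖(1 : 𝔸)‖ * (C + r) ^ n) := by gcongr
        _ = C * (‖(1 : 𝔸)‖ * (C + r) ^ n) := by
          simp only [Finset.sum_const, Finset.card_univ, Fintype.card_fin, nsmul_eq_mul]
          push_cast
          field_simp
        _ ≤ (C + r) * (‖(1 : 𝔸)‖ * (C + r) ^ n) := by gcongr; linarith
        _ = _ := by ring

theorem auxCoef_succ {𝔸 : Type*} [NormedRing 𝔸] [NormedAlgebra ℝ 𝔸] (a : ℕ → 𝔸) (n : ℕ) :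
    ((n : ℝ) + 1) • auxCoef a (n + 1) =
      ∑ kl ∈ Finset.HasAntidiagonal.antidiagonal n, a kl.1 * auxCoef a kl.2 := by
  rw [auxCoef, smul_smul, mul_inv_cancel₀ (by positivity), one_smul,
    ← Finset.Nat.sum_antidiagonal_swap, Finset.Nat.sum_antidiagonal_eq_sum_range_succ_mk,
    Finset.sum_range]
  rfl

/-- Analytic linear ODEs have analytic local solutions. -/
theorem aux_analytic_ode {𝔸 : Type*} [NormedRing 𝔸] [NormedAlgebra ℝ 𝔸] [CompleteSpace 𝔸]
    (A : ℝ → 𝔸) (t0 : ℝ) (hA : AnalyticAt ℝ A t0) :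
    ∃ f : ℝ → 𝔸, AnalyticAt ℝ f t0 ∧ f t0 = 1 ∧ ∀ᶠ t in nhds t0, HasDerivAt f (A t * f t) t := by
  obtain ⟨p, hp⟩ := hA
  obtain ⟨C, r, hC, hr, hb⟩ := p.le_mul_pow_of_radius_pos hp.radius_pos
  set a : ℕ → 𝔸 := p.coeff with ha_def
  have ha : ∀ n, ‖a n‖ ≤ C * r ^ n := by
    intro n
    have h := (p n).le_opNorm (1 : Fin n → ℝ)
    have h2 : ‖a n‖ ≤ ‖p n‖ := by
      refine h.trans (le_of_eq ?_)
      simp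
    exact h2.trans (hb n)
  set u := auxCoef a with hu
  set B := C + r with hB
  have hBpos : 0 < B := by positivity
  have hub : ∀ n, ‖u n‖ ≤ ‖(1 : 𝔸)‖ * B ^ n := auxCoef_bound a C r hC hr ha
  set δ := (2 * B)⁻¹ with hδ
  have hδpos : 0 < δ := by positivity
  have hδB : δ * B = 1 / 2 := by rw [hδ]; field_simp
  have hsumu : ∀ z : ℝ, |z| < δ → Summable fun n => ‖z ^ n • u n‖ := by
    intro z hz
    refine Summable.of_nonneg_of_le (fun n => norm_nonneg _) (fun n => ?_)
      ((summable_geometric_of_lt_one (r := (1 / 2 : ℝ)) (by norm_num) (by norm_num)).mul_left ‖(1 : 𝔸)‖)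
    rw [norm_smul, norm_pow, Real.norm_eq_abs]
    calc |z| ^ n * ‖u n‖ ≤ δ ^ n * (‖(1 : 𝔸)‖ * B ^ n) := by gcongr; exact hub n
      _ = ‖(1 : 𝔸)‖ * (δ * B) ^ n := by rw [mul_pow]; ring
      _ = _ := by rw [hδB]
  have hsuma : ∀ z : ℝ, |z| < δ → Summable fun n => ‖z ^ n • a n‖ := by
    intro z hz
    refine Summable.of_nonneg_of_le (fun n => norm_nonneg _) (fun n => ?_)
      ((summable_geometric_of_lt_one (r := (1 / 2 : ℝ)) (by norm_num) (by norm_num)).mul_left C)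
    rw [norm_smul, norm_pow, Real.norm_eq_abs]
    calc |z| ^ n * ‖a n‖ ≤ δ ^ n * (C * r ^ n) := by gcongr; exact ha n
      _ ≤ δ ^ n * (C * B ^ n) := by gcongr; linarith
      _ = C * (δ * B) ^ n := by rw [mul_pow]; ring
      _ = _ := by rw [hδB]
  have hev : ∀ᶠ t in nhds t0, |t - t0| < δ := by
    have := Metric.ball_mem_nhds t0 hδpos
    filter_upwards [this] with t ht
    simpa [Real.dist_eq] using ht
  let f : ℝ → 𝔸 := fun t => ∑' n, (t - t0) ^ n • u n
  have hA' := hasFPowerSeriesAt_iff'.1 hp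
  refine ⟨f, ?_, ?_, ?_⟩
  · let q : FormalMultilinearSeries ℝ ℝ 𝔸 := fun n => ContinuousMultilinearMap.mkPiRing ℝ (Fin n) (u n)
    have hq : ∀ n, q.coeff n = u n := by
      intro n
      simp [q, FormalMultilinearSeries.coeff]
    refine ⟨q, hasFPowerSeriesAt_iff'.2 ?_⟩
    filter_upwards [hev] with t ht
    simp only [hq]
    exact (hsumu _ ht).of_norm.hasSum
  · change ∑' n, (t0 - t0) ^ n • u n = 1
    rw [tsum_eq_single 0]
    · simp [hu, auxCoef]
    · intro n hn; simp [hn]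
  · filter_upwards [hev, hA'] with t ht hAt
    have hderiv : HasDerivAt f (∑' n : ℕ, ((n : ℝ) * (t - t0) ^ (n - 1)) • u n) t := by
      have hsb : Summable fun n : ℕ => ‖(1 : 𝔸)‖ * B * 2 * ((n : ℝ) * (1 / 2) ^ n) := by
        refine Summable.mul_left _ ?_
        have := summable_pow_mul_geometric_of_norm_lt_one (R := ℝ) 1 (r := 1 / 2) (by norm_num)
        simpa using this
      refine hasDerivAt_tsum_of_isPreconnected
        (g := fun n y => (y - t0) ^ n • u n)
        (g' := fun n y => ((n : ℝ) * (y - t0) ^ (n - 1)) • u n) (t := Metric.ball t0 δ) (y₀ := t) hsb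
        Metric.isOpen_ball (convex_ball t0 δ).isPreconnected ?_ ?_ ?_ ?_ ?_
      · intro n y _
        have h1 : HasDerivAt (fun y : ℝ => (y - t0) ^ n) ((n : ℝ) * (y - t0) ^ (n - 1)) y := by
          simpa using ((hasDerivAt_id y).sub_const t0).fun_pow n
        exact h1.smul_const (u n)
      · intro n y hy
        have hy' : |y - t0| < δ := by simpa [Real.dist_eq] using hy
        rw [norm_smul, norm_mul, norm_pow, Real.norm_eq_abs, Real.norm_eq_abs, Nat.abs_cast]
        cases n with
        | zero => simp
        | succ n =>
          rw [Nat.add_sub_cancel]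
          calc ((n + 1 : ℕ) : ℝ) * |y - t0| ^ n * ‖u (n + 1)‖
              ≤ ((n + 1 : ℕ) : ℝ) * δ ^ n * (‖(1 : 𝔸)‖ * B ^ (n + 1)) := by
                gcongr; exact hub _
            _ = ‖(1 : 𝔸)‖ * B * ((n + 1 : ℕ) : ℝ) * (δ * B) ^ n := by rw [mul_pow]; ring
            _ = _ := by rw [hδB]; ring
      · simpa [Real.dist_eq] using ht
      · exact (hsumu _ ht).of_norm
      · simpa [Real.dist_eq] using ht
    convert hderiv using 1
    have hAt' : A t = ∑' n, (t - t0) ^ n • a n := hAt.tsum_eq.symm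
    have hs1 : Summable fun n : ℕ => ((n : ℝ) * (t - t0) ^ (n - 1)) • u n := by
      rw [← summable_nat_add_iff 1]
      have := (summable_norm_sum_mul_antidiagonal_of_summable_norm (hsuma _ ht) (hsumu _ ht)).of_norm
      refine this.congr fun n => ?_
      rw [Nat.add_sub_cancel, mul_comm, mul_smul]
      push_cast
      rw [auxCoef_succ, Finset.smul_sum]
      refine Finset.sum_congr rfl fun kl hkl => ?_
      rw [smul_mul_smul_comm, ← pow_add, Finset.HasAntidiagonal.mem_antidiagonal.1 hkl]
    rw [hs1.tsum_eq_zero_add, hAt']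
    change _ * ∑' n, (t - t0) ^ n • u n = _
    rw [tsum_mul_tsum_eq_tsum_sum_antidiagonal_of_summable_norm (hsuma _ ht) (hsumu _ ht)]
    simp only [Nat.cast_zero, zero_mul, zero_smul, zero_add]
    refine tsum_congr fun n => ?_
    rw [Nat.add_sub_cancel, mul_comm ((n + 1 : ℕ) : ℝ), mul_smul]
    push_cast
    rw [auxCoef_succ, Finset.smul_sum]
    refine Finset.sum_congr rfl fun kl hkl => ?_
    rw [smul_mul_smul_comm, ← pow_add, Finset.HasAntidiagonal.mem_antidiagonal.1 hkl]

/-- Terms of the Dyson series. -/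
noncomputable def auxDyson {E : Type*} [NormedAddCommGroup E] [NormedSpace ℝ E]
    (A : ℝ → E →L[ℝ] E) (x0 : E) : ℕ → ℝ → E
  | 0 => fun _ => x0
  | n + 1 => fun t => ∫ s in (0 : ℝ)..t, A s (auxDyson A x0 n s)

theorem auxDyson_cont {E : Type*} [NormedAddCommGroup E] [NormedSpace ℝ E] [CompleteSpace E]
    (A : ℝ → E →L[ℝ] E) (hA : Continuous A) (x0 : E) (n : ℕ) : Continuous (auxDyson A x0 n) := by
  induction n with
  | zero => exact continuous_const
  | succ n ih =>
    have h1 : Continuous fun s => A s (auxDyson A x0 n s) := hA.clm_apply ih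
    exact intervalIntegral.continuous_primitive (fun a b => h1.intervalIntegrable a b) 0

theorem auxDyson_deriv {E : Type*} [NormedAddCommGroup E] [NormedSpace ℝ E] [CompleteSpace E]
    (A : ℝ → E →L[ℝ] E) (hA : Continuous A) (x0 : E) (n : ℕ) (t : ℝ) :
    HasDerivAt (auxDyson A x0 (n + 1)) (A t (auxDyson A x0 n t)) t := by
  have h1 : Continuous fun s => A s (auxDyson A x0 n s) := hA.clm_apply (auxDyson_cont A hA x0 n)
  exact (h1.integral_hasStrictDerivAt 0 t).hasDerivAt

theorem auxDyson_bound {E : Type*} [NormedAddCommGroup E] [NormedSpace ℝ E] [CompleteSpace E]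
    (A : ℝ → E →L[ℝ] E) (hA : Continuous A) (x0 : E) (T K : ℝ) (hK0 : 0 ≤ K)
    (hK : ∀ s, |s| ≤ T → ‖A s‖ ≤ K) (n : ℕ) :
    ∀ t, |t| ≤ T → ‖auxDyson A x0 n t‖ ≤ ‖x0‖ * K ^ n * |t| ^ n / n.factorial := by
  induction n with
  | zero => intro t _; simp [auxDyson]
  | succ n ih =>
    intro t ht
    have h1 : Continuous fun s => A s (auxDyson A x0 n s) := hA.clm_apply (auxDyson_cont A hA x0 n)
    have h2 : Continuous fun s : ℝ => (‖x0‖ * K ^ (n + 1) / n.factorial) * |s - 0| ^ n := by fun_prop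
    calc ‖auxDyson A x0 (n + 1) t‖ ≤ ∫ s in Set.uIoc 0 t, ‖A s (auxDyson A x0 n s)‖ :=
          intervalIntegral.norm_integral_le_integral_norm_uIoc
      _ ≤ ∫ s in Set.uIoc 0 t, (‖x0‖ * K ^ (n + 1) / n.factorial) * |s - 0| ^ n := by
          refine MeasureTheory.setIntegral_mono_on (h1.norm.integrableOn_uIoc)
            (h2.integrableOn_uIoc) measurableSet_uIoc ?_
          intro s hs
          have hs' : |s| ≤ T := by
            refine le_trans ?_ ht
            have := Set.abs_sub_left_of_mem_uIcc (Set.uIoc_subset_uIcc hs)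
            simpa using this
          calc ‖A s (auxDyson A x0 n s)‖ ≤ ‖A s‖ * ‖auxDyson A x0 n s‖ := (A s).le_opNorm _
            _ ≤ K * (‖x0‖ * K ^ n * |s| ^ n / n.factorial) := by
              gcongr
              · exact hK s hs'
              · exact ih s hs'
            _ = _ := by rw [sub_zero]; ring
      _ = ‖x0‖ * K ^ (n + 1) * |t| ^ (n + 1) / (n + 1).factorial := by
          rw [MeasureTheory.integral_const_mul, integral_pow_abs_sub_uIoc, Nat.factorial_succ]
          push_cast
          rw [sub_zero]
          field_simp

/-- Global existence for linear ODEs. -/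
theorem aux_global_ode {E : Type*} [NormedAddCommGroup E] [NormedSpace ℝ E] [CompleteSpace E]
    (A : ℝ → E →L[ℝ] E) (hA : Continuous A) (x0 : E) :
    ∃ y : ℝ → E, y 0 = x0 ∧ ∀ t, HasDerivAt y (A t (y t)) t := by
  refine ⟨fun t => ∑' n, auxDyson A x0 n t, ?_, ?_⟩
  · change ∑' n, auxDyson A x0 n 0 = x0
    rw [tsum_eq_single 0]
    · rfl
    · intro n hn
      obtain ⟨k, rfl⟩ := Nat.exists_eq_succ_of_ne_zero hn
      simp [auxDyson]
  · intro t
    set T := |t| + 1 with hT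
    have hT0 : 0 < T := by positivity
    obtain ⟨K, hK⟩ := (isCompact_Icc (a := -T) (b := T)).exists_bound_of_continuousOn hA.continuousOn
    have hK' : ∀ s, |s| ≤ T → ‖A s‖ ≤ K := fun s hs => hK s (abs_le.1 hs)
    have hK0 : 0 ≤ K := (norm_nonneg _).trans (hK' 0 (by simpa using hT0.le))
    have hbd := auxDyson_bound A hA x0 T K hK0 hK'
    have hsum : ∀ s, |s| ≤ T → Summable fun n => auxDyson A x0 n s := by
      intro s hs
      refine Summable.of_norm_bounded (g := fun n => ‖x0‖ * ((K * |s|) ^ n / n.factorial))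
        ((Real.summable_pow_div_factorial _).mul_left _) fun n => ?_
      refine (hbd n s hs).trans (le_of_eq ?_)
      rw [mul_pow]; ring
    have hgs : Summable fun n : ℕ => K * ‖x0‖ * ((K * T) ^ (n - 1) / (n - 1).factorial) := by
      refine Summable.mul_left _ ?_
      rw [← summable_nat_add_iff 1]
      simpa using Real.summable_pow_div_factorial (K * T)
    have htT : |t| ≤ T := by linarith
    have key := hasDerivAt_tsum_of_isPreconnected (g := auxDyson A x0)
      (g' := fun n s => if n = 0 then 0 else A s (auxDyson A x0 (n - 1) s))
      (t := Set.Ioo (-T) T) (y₀ := t) (y := t) hgs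
        isOpen_Ioo isPreconnected_Ioo ?_ ?_ ?_ ?_ ?_
    · convert key using 1
      rw [Summable.tsum_eq_zero_add]
      · simp only [if_true, zero_add, Nat.add_sub_cancel, Nat.succ_ne_zero, if_false]
        exact (A t).map_tsum (hsum t htT)
      · rw [← summable_nat_add_iff 1]
        simp only [Nat.add_sub_cancel, Nat.succ_ne_zero, if_false]
        exact (A t).summable (hsum t htT)
    · intro n s _
      cases n with
      | zero => simpa [auxDyson] using! hasDerivAt_const s x0
      | succ n => simpa using auxDyson_deriv A hA x0 n s
    · intro n s hs
      have hs' : |s| ≤ T := (abs_lt.2 hs).le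
      cases n with
      | zero => simp; positivity
      | succ n =>
        simp only [Nat.add_sub_cancel, Nat.succ_ne_zero, if_false]
        calc ‖A s (auxDyson A x0 n s)‖ ≤ ‖A s‖ * ‖auxDyson A x0 n s‖ := (A s).le_opNorm _
          _ ≤ K * (‖x0‖ * K ^ n * |s| ^ n / n.factorial) := by
              gcongr
              · exact hK' s hs'
              · exact hbd n s hs'
          _ ≤ K * (‖x0‖ * K ^ n * T ^ n / n.factorial) := by gcongr
          _ = _ := by rw [mul_pow]; ring
    · exact abs_lt.1 (by linarith)
    · exact hsum t htT
    · exact abs_lt.1 (by linarith)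

/-- Analytic vanishing. -/
theorem aux_vanish {E : Type*} [NormedAddCommGroup E] [NormedSpace ℝ E] [CompleteSpace E]
    (W : ℕ → ℝ → E) (B : ℝ → E →L[ℝ] E) (t : ℝ) (hW : ∀ n, AnalyticAt ℝ (W n) t)
    (hB : AnalyticAt ℝ B t)
    (hd : ∀ n, ∀ᶠ s in nhds t, HasDerivAt (W n) (W (n + 1) s + B s (W n s)) s)
    (h0 : ∀ n, W n t = 0) (n : ℕ) : ∀ᶠ s in nhds t, W n s = 0 := by
  have key : ∀ k : ℕ, ∀ n, (k : ℕ∞) ≤ analyticOrderAt (W n) t := by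
    intro k
    induction k with
    | zero => intro n; simp
    | succ k ih =>
      intro n
      have h1 : (k : ℕ∞) ≤ analyticOrderAt (deriv (W n)) t := by
        rw [natCast_le_analyticOrderAt (hW n).deriv]
        obtain ⟨g1, hg1, e1⟩ := (natCast_le_analyticOrderAt (hW (n + 1))).1 (ih (n + 1))
        obtain ⟨g2, hg2, e2⟩ := (natCast_le_analyticOrderAt (hW n)).1 (ih n)
        refine ⟨fun s => g1 s + B s (g2 s), hg1.add
          (((ContinuousLinearMap.id ℝ (E →L[ℝ] E)).analyticAt_bilinear (B t, g2 t)).comp₂ hB hg2), ?_⟩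
        filter_upwards [e1, e2, hd n] with s h1 h2 h3
        rw [h3.deriv, h1, h2, map_smul, smul_add]
      have h2 := (hW n).analyticOrderAt_deriv_add_one
      simp only [h0, sub_zero] at h2
      rw [← h2]
      push_cast
      gcongr
  have : analyticOrderAt (W n) t = ⊤ := by
    rw [ENat.eq_top_iff_forall_ge]
    exact fun k => key k n
  exact analyticOrderAt_eq_top.1 this

/-- Real continuous bilinear maps of a normed space. -/
abbrev AuxBil (E : Type*) [NormedAddCommGroup E] [NormedSpace ℝ E] := E →L[ℝ] E →L[ℝ] E

theorem auxBil_analytic {E : Type*} [NormedAddCommGroup E] [NormedSpace ℝ E] (C : AuxBil E)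
    {f g : ℝ → E} {t : ℝ} (hf : AnalyticAt ℝ f t) (hg : AnalyticAt ℝ g t) :
    AnalyticAt ℝ (fun s => C (f s) (g s)) t :=
  (C.analyticAt_bilinear (f t, g t)).comp₂ hf hg

theorem auxBil_deriv {E : Type*} [NormedAddCommGroup E] [NormedSpace ℝ E] (C : AuxBil E)
    {f g : ℝ → E} {f' g' : E} {t : ℝ} (hf : HasDerivAt f f' t) (hg : HasDerivAt g g' t) :
    HasDerivAt (fun s => C (f s) (g s)) (C (f t) g' + C f' (g t)) t :=
  C.hasDerivAt_of_bilinear (fun _ => hf) (fun _ => hg)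

/-- Local step: the commutators vanish a bit to the right. -/
theorem aux_step {E : Type*} [NormedAddCommGroup E] [NormedSpace ℝ E] [CompleteSpace E]
    {ι : Type*} [Finite ι] (C B : AuxBil E)
    (hJ : ∀ h Z G G' : E, C Z (G' + B h G) + C (B h Z) G = C Z G' + B h (C Z G))
    (H : ℝ → E) (G : ι → ℕ → ℝ → E)
    (hH : ∀ t : ℝ, 0 ≤ t → AnalyticAt ℝ H t)
    (hG : ∀ m n, ∀ t : ℝ, 0 ≤ t → AnalyticAt ℝ (G m n) t)
    (t : ℝ) (ht : 0 ≤ t)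
    (hGd : ∀ m n, ∀ s, 0 ≤ s → HasDerivAt (G m n) (G m (n + 1) s + B (H s) (G m n s)) s)
    (hGd' : ∀ m n, ∀ᶠ s in nhds t, HasDerivAt (G m n) (G m (n + 1) s + B (H s) (G m n s)) s)
    (X : ℝ → E)
    (hX : ∀ t, 0 ≤ t → HasDerivAt X (B (H t) (X t)) t)
    (h0 : ∀ m n, C (X t) (G m n t) = 0) :
    ∃ ε > 0, ∀ s ∈ Set.Ioo t (t + ε), ∀ m n, C (X s) (G m n s) = 0 := by
  have hBan : AnalyticAt ℝ (fun s => B (H s)) t :=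
    (B.analyticAt (H t)).comp (hH t ht)
  obtain ⟨f, hfa, hf1, hfd⟩ := aux_analytic_ode (fun s => B (H s)) t hBan
  let ev := ContinuousLinearMap.apply ℝ E (X t)
  let Z : ℝ → E := fun s => f s (X t)
  have hZa : AnalyticAt ℝ Z t := (ev.analyticAt (f t)).comp hfa
  have hZt : Z t = X t := by simp [Z, hf1]
  have hZd : ∀ᶠ s in nhds t, HasDerivAt Z (B (H s) (Z s)) s := by
    filter_upwards [hfd] with s hs
    exact ev.hasFDerivAt.comp_hasDerivAt s hs
  have hZ0 : ∀ m, ∀ᶠ s in nhds t, C (Z s) (G m 0 s) = 0 := by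
    intro m
    refine aux_vanish (fun n s => C (Z s) (G m n s))
      (fun s => B (H s)) t
      (fun n => auxBil_analytic C hZa (hG m n t ht)) hBan ?_ ?_ 0
    · intro n
      filter_upwards [hZd, hGd' m n] with s h1 h2
      rw [← hJ]
      exact auxBil_deriv C h1 h2
    · intro n
      change C (Z t) _ = 0
      rw [hZt]
      exact h0 m n
  have hHb : ∀ᶠ s in nhds t, ‖B (H s)‖ < ‖B (H t)‖ + 1 :=
    hBan.continuousAt.norm.eventually (gt_mem_nhds (by linarith))
  obtain ⟨ε, hε, hball⟩ := Metric.eventually_nhds_iff.1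
    ((hZd.and hHb).and (eventually_all.2 hZ0))
  refine ⟨ε, hε, ?_⟩
  have hin : ∀ s ∈ Set.Ico t (t + ε), dist s t < ε := by
    intro s hs
    rw [Real.dist_eq, abs_of_nonneg (by linarith [hs.1])]
    linarith [hs.2]
  have hXZ : ∀ s ∈ Set.Ioo t (t + ε), X s = Z s := by
    intro b hb
    have hin' : ∀ s ∈ Set.Icc t b, dist s t < ε := fun s hs =>
      hin s ⟨hs.1, hs.2.trans_lt hb.2⟩
    have := ODE_solution_unique_of_mem_Icc_right (a := t) (b := b) (f := X) (g := Z)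
      (v := fun s x => B (H s) x) (s := fun _ => Set.univ)
      (K := ‖B (H t)‖₊ + 1) ?_ ?_ ?_ ?_ ?_ ?_ ?_ ?_
    · exact this ⟨hb.1.le, le_rfl⟩
    · intro s hs
      refine (LipschitzWith.weaken (B (H s)).lipschitz ?_).lipschitzOnWith
      have := (hball (hin' s ⟨hs.1, hs.2.le⟩)).1.2.le
      exact_mod_cast this
    · intro s hs
      exact (hX s (ht.trans hs.1)).continuousAt.continuousWithinAt
    · intro s hs
      exact (hX s (ht.trans hs.1)).hasDerivWithinAt
    · intro s _; trivial
    · intro s hs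
      exact (hball (hin' s hs)).1.1.continuousAt.continuousWithinAt
    · intro s hs
      exact (hball (hin' s ⟨hs.1, hs.2.le⟩)).1.1.hasDerivWithinAt
    · intro s _; trivial
    · exact hZt.symm
  intro s hs m n
  revert s
  induction n with
  | zero =>
    intro s hs
    rw [hXZ s hs]
    exact (hball (hin s ⟨hs.1.le, hs.2⟩)).2 m
  | succ n ih =>
    intro s hs
    have hs0 : 0 ≤ s := ht.trans hs.1.le
    have h1 := auxBil_deriv C (hX s hs0) (hGd m n s hs0)
    rw [hJ, ih s hs, map_zero, add_zero] at h1
    have h2 : (fun s => C (X s) (G m n s)) =ᶠ[nhds s] fun _ => 0 := by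
      filter_upwards [isOpen_Ioo.mem_nhds hs] with r hr
      exact ih r hr
    have h3 := (hasDerivAt_const s (0 : E)).congr_of_eventuallyEq h2
    exact h1.unique h3

theorem aux_commute_all {E : Type*} [NormedAddCommGroup E] [NormedSpace ℝ E] [CompleteSpace E]
    {ι : Type*} [Finite ι] (C B : AuxBil E)
    (hJ : ∀ h Z G G' : E, C Z (G' + B h G) + C (B h Z) G = C Z G' + B h (C Z G))
    (H : ℝ → E) (G : ι → ℕ → ℝ → E)
    (hH : ∀ t : ℝ, 0 ≤ t → AnalyticAt ℝ H t)
    (hG : ∀ m n, ∀ t : ℝ, 0 ≤ t → AnalyticAt ℝ (G m n) t)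
    (hGd : ∀ m n, ∀ s, 0 ≤ s → HasDerivAt (G m n) (G m (n + 1) s + B (H s) (G m n s)) s)
    (hGd' : ∀ m n, ∀ t, 0 ≤ t →
      ∀ᶠ s in nhds t, HasDerivAt (G m n) (G m (n + 1) s + B (H s) (G m n s)) s)
    (X : ℝ → E)
    (hX : ∀ t, 0 ≤ t → HasDerivAt X (B (H t) (X t)) t)
    (h0 : ∀ m n, C (X 0) (G m n 0) = 0) (b : ℝ) (hb : 0 ≤ b) (m : ι) :
    C (X b) (G m 0 b) = 0 := by
  let S : Set ℝ := {t | ∀ m n, C (X t) (G m n t) = 0}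
  have hcl : IsClosed (S ∩ Set.Icc 0 b) := by
    have : S ∩ Set.Icc 0 b = Set.Icc 0 b ∩ ⋂ m, ⋂ n,
        (Set.Icc 0 b ∩ (fun t => C (X t) (G m n t)) ⁻¹' {0}) := by
      ext t
      constructor
      · rintro ⟨h, ht⟩
        exact ⟨ht, Set.mem_iInter.2 fun m => Set.mem_iInter.2 fun n => ⟨ht, h m n⟩⟩
      · rintro ⟨ht, h⟩
        exact ⟨fun m n => (Set.mem_iInter.1 (Set.mem_iInter.1 h m) n).2, ht⟩
    rw [this]
    refine isClosed_Icc.inter (isClosed_iInter fun m => isClosed_iInter fun n => ?_)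
    refine ContinuousOn.preimage_isClosed_of_isClosed ?_ isClosed_Icc isClosed_singleton
    intro t ht
    exact (auxBil_deriv C (hX t ht.1) (hGd m n t ht.1)).continuousAt.continuousWithinAt
  have hsub : Set.Icc 0 b ⊆ S := by
    refine hcl.Icc_subset_of_forall_exists_gt h0 ?_
    rintro x ⟨hxS, hx⟩ y hy
    obtain ⟨ε, hε, h⟩ := aux_step C B hJ H G hH hG x hx.1 hGd (fun m n => hGd' m n x hx.1) X hX hxS
    have hy' : x < y := hy
    refine ⟨min y (x + ε / 2), h _ ⟨?_, ?_⟩, ?_, min_le_left _ _⟩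
    · exact lt_min hy' (by linarith)
    · exact (min_le_right _ _).trans_lt (by linarith)
    · exact lt_min hy' (by linarith)
  exact hsub ⟨hb, le_rfl⟩ m 0


/-- The bilinear map `c • [X, Y]` on matrices, as a real continuous bilinear map. -/
noncomputable def auxC (d : ℕ) (c : ℂ) : AuxBil (Matrix (Fin d) (Fin d) ℂ) :=
  LinearMap.toContinuousLinearMap
    ((LinearMap.toContinuousLinearMap : (Matrix (Fin d) (Fin d) ℂ →ₗ[ℝ] Matrix (Fin d) (Fin d) ℂ)
        ≃ₗ[ℝ] _).toLinearMap ∘ₗ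
      LinearMap.mk₂ ℝ (fun X Y : Matrix (Fin d) (Fin d) ℂ => c • (X * Y - Y * X))
        (by intro a b e; rw [← smul_add]; congr 1; noncomm_ring)
        (by intro r a b; rw [smul_comm r c]; congr 1; simp [smul_sub])
        (by intro a b e; rw [← smul_add]; congr 1; noncomm_ring)
        (by intro r a b; rw [smul_comm r c]; congr 1; simp [smul_sub]))

theorem auxC_apply (d : ℕ) (c : ℂ) (X Y : Matrix (Fin d) (Fin d) ℂ) :
    auxC d c X Y = c • (X * Y - Y * X) := rfl

theorem auxC_analytic {d : ℕ} (c : ℂ) {f g : ℝ → Matrix (Fin d) (Fin d) ℂ} {t : ℝ}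
    (hf : AnalyticAt ℝ f t) (hg : AnalyticAt ℝ g t) :
    AnalyticAt ℝ (fun s => auxC d c (f s) (g s)) t :=
  ((auxC d c).analyticAt_bilinear (f t, g t)).comp₂ hf hg

theorem auxC_deriv {d : ℕ} (c : ℂ) {f g : ℝ → Matrix (Fin d) (Fin d) ℂ}
    {f' g' : Matrix (Fin d) (Fin d) ℂ} {t : ℝ}
    (hf : HasDerivAt f f' t) (hg : HasDerivAt g g' t) :
    HasDerivAt (fun s => auxC d c (f s) (g s)) (auxC d c (f t) g' + auxC d c f' (g t)) t :=
  (auxC d c).hasDerivAt_of_bilinear (fun _ => hf) (fun _ => hg)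

theorem adPow_analytic {d : ℕ} {H A : ℝ → Matrix (Fin d) (Fin d) ℂ} {t : ℝ}
    (hH : AnalyticAt ℝ H t) (hA : AnalyticAt ℝ A t) (n : ℕ) : AnalyticAt ℝ (adPow H n A) t := by
  have : CompleteSpace (Matrix (Fin d) (Fin d) ℂ) := FiniteDimensional.complete ℝ _
  induction n with
  | zero => exact hA
  | succ n ih => exact (auxC_analytic Complex.I hH ih).add ih.deriv

theorem adPow_deriv {d : ℕ} {H A : ℝ → Matrix (Fin d) (Fin d) ℂ} {t : ℝ}
    (hH : AnalyticAt ℝ H t) (hA : AnalyticAt ℝ A t) (n : ℕ) :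
    HasDerivAt (adPow H n A)
      (adPow H (n + 1) A t + auxC d (-Complex.I) (H t) (adPow H n A t)) t := by
  have h := (adPow_analytic hH hA n).differentiableAt.hasDerivAt
  have e : adPow H (n + 1) A t + auxC d (-Complex.I) (H t) (adPow H n A t) =
      deriv (adPow H n A) t := by
    change Complex.I • (H t * adPow H n A t - adPow H n A t * H t) + deriv (adPow H n A) t +
      (-Complex.I) • (H t * adPow H n A t - adPow H n A t * H t) = _
    rw [neg_smul]
    abel
  exact h.congr_deriv e.symm

theorem adPow_hermitian {d : ℕ} {H A : ℝ → Matrix (Fin d) (Fin d) ℂ}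
    (hHa : ∀ t, 0 ≤ t → AnalyticAt ℝ H t) (hAa : ∀ t, 0 ≤ t → AnalyticAt ℝ A t)
    (hH : ∀ t, 0 ≤ t → (H t).IsHermitian) (hA : ∀ t, 0 ≤ t → (A t).IsHermitian) (n : ℕ) :
    ∀ t, 0 ≤ t → (adPow H n A t).IsHermitian := by
  induction n with
  | zero => exact hA
  | succ n ih =>
    intro t ht
    have h := (adPow_analytic (hHa t ht) (hAa t ht) n).differentiableAt.hasDerivAt
    let S : Matrix (Fin d) (Fin d) ℂ →L[ℝ] Matrix (Fin d) (Fin d) ℂ :=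
      LinearMap.toContinuousLinearMap
        { toFun := fun X => Xᴴ
          map_add' := fun X Y => conjTranspose_add X Y
          map_smul' := fun r X => by simp }
    have h2 : HasDerivAt (fun s => (adPow H n A s)ᴴ) ((deriv (adPow H n A) t)ᴴ) t :=
      S.hasFDerivAt.comp_hasDerivAt t h
    have h3 : HasDerivWithinAt (adPow H n A) ((deriv (adPow H n A) t)ᴴ) (Set.Ici t) t := by
      refine h2.hasDerivWithinAt.congr (fun s hs => ?_) ?_
      · exact (ih s (ht.trans hs)).eq.symm
      · exact (ih t ht).eq.symm
    have h4 : (deriv (adPow H n A) t)ᴴ = deriv (adPow H n A) t :=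
      (uniqueDiffWithinAt_Ici t).eq_deriv _ h3 h.hasDerivWithinAt
    change (Complex.I • (H t * adPow H n A t - adPow H n A t * H t) + deriv (adPow H n A) t)ᴴ =
      Complex.I • (H t * adPow H n A t - adPow H n A t * H t) + deriv (adPow H n A) t
    rw [conjTranspose_add, h4, conjTranspose_smul, conjTranspose_sub, conjTranspose_mul,
      conjTranspose_mul, (ih t ht).eq, (hH t ht).eq]
    congr 1
    simp only [RCLike.star_def, Complex.conj_I, neg_smul, ← smul_neg, neg_sub]

theorem aux_jacobi {d : ℕ} (h Z G G' : Matrix (Fin d) (Fin d) ℂ) :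
    auxC d 1 Z (G' + auxC d (-Complex.I) h G) + auxC d 1 (auxC d (-Complex.I) h Z) G =
      auxC d 1 Z G' + auxC d (-Complex.I) h (auxC d 1 Z G) := by
  simp only [auxC_apply, one_smul, neg_smul, mul_sub, sub_mul, mul_smul_comm, smul_mul_assoc,
    smul_sub, neg_mul, mul_neg, mul_assoc, mul_add, add_mul]
  abel

/-- The purity is preserved under the unitary evolution. -/
theorem aux_purity {d : ℕ} (H X : ℝ → Matrix (Fin d) (Fin d) ℂ)
    (hX : ∀ t, 0 ≤ t → HasDerivAt X (auxC d (-Complex.I) (H t) (X t)) t) (b : ℝ) (hb : 0 ≤ b) :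
    Matrix.trace (X b * X b) = Matrix.trace (X 0 * X 0) := by
  let tr : Matrix (Fin d) (Fin d) ℂ →L[ℝ] Matrix (Fin d) (Fin d) ℂ →L[ℝ] ℂ :=
    LinearMap.toContinuousLinearMap
    ((LinearMap.toContinuousLinearMap : (Matrix (Fin d) (Fin d) ℂ →ₗ[ℝ] ℂ)
        ≃ₗ[ℝ] _).toLinearMap ∘ₗ
      LinearMap.mk₂ ℝ (fun X Y : Matrix (Fin d) (Fin d) ℂ => Matrix.trace (X * Y))
        (by intro a b e; rw [add_mul, trace_add])
        (by intro r a b; rw [smul_mul_assoc, trace_smul])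
        (by intro a b e; rw [mul_add, trace_add])
        (by intro r a b; rw [mul_smul_comm, trace_smul]))
  have htr : ∀ X Y, tr X Y = Matrix.trace (X * Y) := fun _ _ => rfl
  have hder : ∀ t, 0 ≤ t → HasDerivAt (fun t => tr (X t) (X t)) 0 t := by
    intro t ht
    have := tr.hasDerivAt_of_bilinear (fun _ => hX t ht) (fun _ => hX t ht)
    refine this.congr_deriv ?_
    change Matrix.trace (X t * ((-Complex.I) • (H t * X t - X t * H t))) +
      Matrix.trace (((-Complex.I) • (H t * X t - X t * H t)) * X t) = 0
    rw [ mul_smul_comm, smul_mul_assoc, trace_smul, trace_smul, mul_sub,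
      sub_mul, trace_sub, trace_sub, trace_mul_comm (H t * X t) (X t), mul_assoc (X t) (H t),
      ← smul_add, trace_mul_comm (X t) (X t * H t), mul_assoc (X t) (H t)]
    simp
  have := constant_of_derivWithin_zero (a := 0) (b := b) (f := fun t => tr (X t) (X t)) ?_ ?_ b ⟨hb, le_rfl⟩
  · exact this
  · intro t ht
    exact (hder t ht.1).differentiableAt.differentiableWithinAt
  · intro t ht
    exact (hder t ht.1).hasDerivWithinAt.derivWithin
      ((uniqueDiffOn_Icc (ht.1.trans_lt ht.2)) t ⟨ht.1, ht.2.le⟩)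

/-- for analytic generators, uniqueness of the steady state implies that
the algebra `A^ad` is full at some time `t0 ≥ 0`. -/
theorem stmt2 {d M : ℕ} (hd : 0 < d)
    (H : ℝ → Matrix (Fin d) (Fin d) ℂ)
    (L : Fin M → ℝ → Matrix (Fin d) (Fin d) ℂ)
    (hH : ∀ t : ℝ, 0 ≤ t → (H t).IsHermitian)
    (hL : ∀ m, ∀ t : ℝ, 0 ≤ t → (L m t).IsHermitian)
    (hQ : CondQ (gksl H L))
    (hana : ∀ t : ℝ, 0 ≤ t →
      AnalyticAt ℝ H t ∧ ∀ m, AnalyticAt ℝ (L m) t)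
    (huniq : ∀ ρ0 : Matrix (Fin d) (Fin d) ℂ, IsDensity ρ0 →
      ∀ ρ : ℝ → Matrix (Fin d) (Fin d) ℂ, ρ 0 = ρ0 →
        (∀ t : ℝ, 0 ≤ t → HasDerivAt ρ (gksl H L t (ρ t)) t) →
        Tendsto ρ atTop (nhds (((d : ℂ))⁻¹ • (1 : Matrix (Fin d) (Fin d) ℂ)))) :
    ∃ t0 : ℝ, 0 ≤ t0 ∧ Algebra.adjoin ℂ
        {A : Matrix (Fin d) (Fin d) ℂ | ∃ m n, A = adPow H n (L m) t0} = ⊤ := by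
  have : CompleteSpace (Matrix (Fin d) (Fin d) ℂ) := FiniteDimensional.complete ℝ _
  have hHa : ∀ t : ℝ, 0 ≤ t → AnalyticAt ℝ H t := fun t ht => (hana t ht).1
  have hLa : ∀ m, ∀ t : ℝ, 0 ≤ t → AnalyticAt ℝ (L m) t := fun m t ht => (hana t ht).2 m
  refine ⟨0, le_rfl, aux_burnside hd _ ?_ ?_⟩
  · rintro A ⟨m, n, rfl⟩
    exact adPow_hermitian hHa (hLa m) hH (hL m) n 0 le_rfl
  intro P hPH hPP hPc
  by_cases hP0 : P = 0
  · exact Or.inl hP0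
  right
  have hpsd : P.PosSemidef := by
    have := Matrix.posSemidef_conjTranspose_mul_self P
    rwa [hPH.eq, hPP] at this
  set r : ℂ := Matrix.trace P with hr
  have hr0 : r ≠ 0 := by
    intro h
    apply hP0
    have : Matrix.trace (Pᴴ * P) = 0 := by rw [hPH.eq, hPP]; exact h
    exact Matrix.trace_conjTranspose_mul_self_eq_zero_iff.1 this
  have hrn : 0 ≤ r := hpsd.trace_nonneg
  have hrinv : 0 ≤ r⁻¹ := inv_nonneg.2 hrn
  have hcont : Continuous fun t : ℝ => auxC d (-Complex.I) (H (max t 0)) := by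
    refine (auxC d (-Complex.I)).continuous.comp ?_
    rw [continuous_iff_continuousAt]
    intro t
    exact ContinuousAt.comp (f := fun t : ℝ => max t 0) (g := H)
      (hHa (max t 0) (le_max_right _ _)).continuousAt (by fun_prop)
  obtain ⟨X, hX0, hXd'⟩ := aux_global_ode _ hcont (r⁻¹ • P)
  have hXd : ∀ t, 0 ≤ t → HasDerivAt X (auxC d (-Complex.I) (H t) (X t)) t := by
    intro t ht
    have := hXd' t
    rwa [max_eq_left ht] at this
  have hcomm := aux_commute_all (auxC d 1) (auxC d (-Complex.I)) aux_jacobi H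
    (fun m n => adPow H n (L m)) hHa (fun m n t ht => adPow_analytic (hHa t ht) (hLa m t ht) n)
    (fun m n t ht => adPow_deriv (hHa t ht) (hLa m t ht) n)
    (fun m n t ht => by
      filter_upwards [(hHa t ht).eventually_analyticAt, (hLa m t ht).eventually_analyticAt]
        with s h2 h3
      exact adPow_deriv h2 h3 n) X hXd (by
    intro m n
    rw [auxC_apply, hX0, one_smul, smul_mul_assoc, mul_smul_comm, hPc _ ⟨m, n, rfl⟩, sub_self])
  have hlim := huniq (r⁻¹ • P) ⟨hpsd.smul hrinv, by
      rw [trace_smul, smul_eq_mul, ← hr, inv_mul_cancel₀ hr0]⟩ X hX0 (by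
    intro t ht
    refine (hXd t ht).congr_deriv (Eq.symm ?_)
    rw [gksl, auxC_apply]
    refine add_eq_left.2 (Finset.sum_eq_zero fun m _ => ?_)
    have hc : X t * L m t = L m t * X t := by
      have : auxC d 1 (X t) (L m t) = 0 := hcomm t ht m
      rw [auxC_apply, one_smul] at this
      exact sub_eq_zero.1 this
    have h1 : L m t * X t * L m t = L m t ^ 2 * X t := by
      rw [mul_assoc, hc, pow_two, mul_assoc]
    have h2 : X t * L m t ^ 2 = L m t ^ 2 * X t := by
      rw [pow_two, ← mul_assoc, hc, mul_assoc, hc, mul_assoc]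
    rw [h1, h2, ← two_smul ℂ, smul_smul]
    norm_num)
  have hlim2 : Tendsto (fun t => Matrix.trace (X t * X t)) atTop
      (nhds (Matrix.trace (((d : ℂ)⁻¹ • (1 : Matrix (Fin d) (Fin d) ℂ)) *
        ((d : ℂ)⁻¹ • (1 : Matrix (Fin d) (Fin d) ℂ))))) := by
    have hc : Continuous fun Y : Matrix (Fin d) (Fin d) ℂ => Matrix.trace (Y * Y) := by fun_prop
    exact (hc.tendsto _).comp hlim
  have hlim3 : Tendsto (fun t => Matrix.trace (X t * X t)) atTop
      (nhds (Matrix.trace (X 0 * X 0))) := by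
    refine tendsto_const_nhds.congr' ?_
    filter_upwards [eventually_ge_atTop 0] with t ht
    exact (aux_purity H X hXd t ht).symm
  have heq := tendsto_nhds_unique hlim2 hlim3
  have hdc : (d : ℂ) ≠ 0 := Nat.cast_ne_zero.2 hd.ne'
  rw [hX0] at heq
  simp only [smul_mul_assoc, mul_smul_comm, trace_smul, hPP, ← hr, mul_one, trace_one,
    Fintype.card_fin, smul_eq_mul] at heq
  rw [inv_mul_cancel₀ hdc, inv_mul_cancel₀ hr0, mul_one, mul_one] at heq
  have hrd : r = d := (inv_injective heq).symm
  have : Matrix.trace ((1 - P)ᴴ * (1 - P)) = 0 := by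
    rw [conjTranspose_sub, conjTranspose_one, hPH.eq]
    have : (1 - P) * (1 - P) = 1 - P := by
      simp only [mul_sub, sub_mul, mul_one, one_mul, hPP]
      abel
    rw [this, trace_sub, trace_one, ← hr, hrd]
    simp
  exact (sub_eq_zero.1 (Matrix.trace_conjTranspose_mul_self_eq_zero_iff.1 this)).symm
end
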